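/- arXiv:1103.5809 — 5 statements merged into one kernel-verified Lean document; each statement's English description precedes it below -/
import Mathlib

section
/- Let I be the radical ideal of 5 general points of P^2, i.e., there is a nonempty Zariski-open subset U of (P^2)^5 such that for every 5-tuple of pairwise distinct points (p_1,...,p_5) ∈ U, the ideal I = ∩_i I(p_i) satisfies: I^(2r) = (I^(2))^r and I^(2r+1) = I^(2r)·I for all r ≥ 1. -/
open MvPolynomial
open scoped LinearAlgebra.Projectivization

noncomputable section

/-- The homogeneous vanishing ideal of a point of projective `N`-space:
the ideal generated by all forms vanishing at the point. -/
def pointIdeal {K : Type*} [Field K] {N : ℕ} (q : ℙ K (Fin (N + 1) → K)) :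
    Ideal (MvPolynomial (Fin (N + 1)) K) :=
  Ideal.span {f | (∃ d : ℕ, f.IsHomogeneous d) ∧ MvPolynomial.eval q.rep f = 0}

theorem symbolic_powers_of_section {R S ι : Type*} [CommRing R] [CommRing S]
    (φ : R →+* S) (c q : R) (g : S) (P : ι → Ideal R)
    (hc : φ c = 0) (hker : ∀ f, φ f = 0 → c ∣ f)
    (hdvd : ∀ m, ∀ f ∈ ⨅ i, P i ^ m, g ^ m ∣ φ f)
    (hmem : ∀ f, g ∣ φ f → f ∈ ⨅ i, P i)
    (hcancel : ∀ m f, c * f ∈ ⨅ i, P i ^ (m + 1) → f ∈ ⨅ i, P i ^ m)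
    (hq : q ∈ ⨅ i, P i ^ 2) (hφq : φ q = g ^ 2)
    (hrange : ∀ h, g ^ 2 * h ∈ φ.range → h ∈ φ.range) (r : ℕ) :
    (⨅ i, P i ^ (2 * r)) = (⨅ i, P i ^ 2) ^ r ∧
      (⨅ i, P i ^ (2 * r + 1)) = (⨅ i, P i ^ (2 * r)) * (⨅ i, P i) := by
  have hmul : ∀ a b x y, x ∈ ⨅ i, P i ^ a → y ∈ ⨅ i, P i ^ b → x * y ∈ ⨅ i, P i ^ (a + b) := by
    intro a b x y hx hy
    rw [Ideal.mem_iInf] at *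
    intro i
    rw [pow_add]
    exact Ideal.mul_mem_mul (hx i) (hy i)
  have hone : (⨅ i, P i ^ 1) = ⨅ i, P i := by simp
  have hqpow : ∀ r, q ^ r ∈ ⨅ i, P i ^ (2 * r) := by
    intro r
    induction r with
    | zero => simp
    | succ r ih => rw [pow_succ, mul_add]; exact hmul _ _ _ _ ih hq
  have hcI : c ∈ ⨅ i, P i ^ 1 := by
    rw [hone]; exact hmem c (by simp [hc])
  have hrange' : ∀ r h, g ^ (2 * r) * h ∈ φ.range → h ∈ φ.range := by
    intro r
    induction r with
    | zero => intro h hh; simpa using hh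
    | succ r ih =>
      intro h hh
      refine hrange h (ih _ ?_)
      rwa [← mul_assoc, ← pow_add]
  have hdecomp : ∀ r m f, 2 * r ≤ m → f ∈ ⨅ i, P i ^ m →
      ∃ h f', f = q ^ r * h + c * f' ∧ g ^ (m - 2 * r) ∣ φ h := by
    intro r m f hm hf
    obtain ⟨k, rfl⟩ := Nat.exists_eq_add_of_le hm
    obtain ⟨w, hw⟩ := hdvd _ f hf
    obtain ⟨h, hh⟩ := hrange' r (g ^ k * w) ⟨f, by rw [hw]; ring⟩
    obtain ⟨f', hf'⟩ := hker (f - q ^ r * h) (by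
      rw [map_sub, map_mul, map_pow, hh, hφq, hw]; ring)
    refine ⟨h, f', by rw [← hf']; ring, ?_⟩
    rw [hh, Nat.add_sub_cancel_left]
    exact dvd_mul_right _ _
  have hodd : ∀ r, ∀ f ∈ ⨅ i, P i ^ (2 * r + 1),
      ∃ h ∈ ⨅ i, P i, ∃ f' ∈ ⨅ i, P i ^ (2 * r), f = q ^ r * h + c * f' := by
    intro r f hf
    obtain ⟨h, f', he, hd⟩ := hdecomp r _ f (by omega) hf
    have hh : h ∈ ⨅ i, P i := hmem h (by simpa using hd)
    refine ⟨h, hh, f', hcancel _ _ ?_, he⟩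
    have : c * f' = f - q ^ r * h := by rw [he]; ring
    rw [this]
    exact sub_mem hf (hmul _ _ _ _ (hqpow r) (by rwa [hone]))
  have heven : ∀ r, ∀ f ∈ ⨅ i, P i ^ (2 * (r + 1)),
      ∃ h, ∃ f' ∈ ⨅ i, P i ^ (2 * r + 1), f = q ^ (r + 1) * h + c * f' := by
    intro r f hf
    obtain ⟨h, f', he, -⟩ := hdecomp (r + 1) _ f le_rfl hf
    refine ⟨h, f', hcancel _ _ ?_, he⟩
    have : c * f' = f - q ^ (r + 1) * h := by rw [he]; ring
    rw [this]
    exact sub_mem hf (Ideal.mul_mem_right _ _ (hqpow (r + 1)))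
  refine ⟨le_antisymm ?_ ?_, le_antisymm ?_ ?_⟩
  · induction r with
    | zero => simp
    | succ r ih =>
      intro f hf
      obtain ⟨h, f₁, hf₁, rfl⟩ := heven r f hf
      obtain ⟨h₁, hh₁, f₂, hf₂, rfl⟩ := hodd r f₁ hf₁
      have e : q ^ (r + 1) * h + c * (q ^ r * h₁ + c * f₂) =
          q ^ (r + 1) * h + (q ^ r * (c * h₁) + f₂ * (c * c)) := by ring
      rw [e]
      refine add_mem (Ideal.mul_mem_right _ _ (Ideal.pow_mem_pow hq _)) (add_mem ?_ ?_)
      · rw [pow_succ]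
        exact Ideal.mul_mem_mul (Ideal.pow_mem_pow hq _) (hmul 1 1 _ _ hcI (by rwa [hone]))
      · rw [pow_succ]
        exact Ideal.mul_mem_mul (ih hf₂) (hmul 1 1 _ _ hcI hcI)
  · refine le_iInf fun i => ?_
    rw [pow_mul]
    exact Ideal.pow_right_mono (iInf_le _ i) r
  · intro f hf
    obtain ⟨h, hh, f', hf', rfl⟩ := hodd r f hf
    refine add_mem (Ideal.mul_mem_mul (hqpow r) hh) ?_
    rw [mul_comm c]
    exact Ideal.mul_mem_mul hf' (by rwa [hone] at hcI)
  · rw [Ideal.mul_le]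
    intro x hx y hy
    exact hmul _ 1 _ _ hx (by rwa [hone])

section LineIdeal

variable {σ K : Type*} [Field K]

/-- Restriction of polynomials to the line through the origin spanned by `v`. -/
def lineEval (v : σ → K) : MvPolynomial σ K →ₐ[K] Polynomial K :=
  aeval fun i => Polynomial.C (v i) * Polynomial.X

/-- The ideal of polynomials vanishing on the line through the origin spanned by `v`. -/
def lineIdeal (v : σ → K) : Ideal (MvPolynomial σ K) :=
  RingHom.ker (lineEval v)

theorem mem_lineIdeal {v : σ → K} {f : MvPolynomial σ K} :
    f ∈ lineIdeal v ↔ lineEval v f = 0 :=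
  RingHom.mem_ker

theorem aeval_C_mul (v : σ → K) {A : Type*} [CommRing A] [Algebra K A] (z : A)
    (f : MvPolynomial σ K) :
    aeval (fun i => algebraMap K A (v i) * z) f = Polynomial.aeval z (lineEval v f) := by
  have : (aeval (fun i => algebraMap K A (v i) * z) : MvPolynomial σ K →ₐ[K] A) =
      (Polynomial.aeval z).comp (lineEval v) := by
    ext i
    simp [lineEval]
  rw [this]; rfl

theorem sub_aeval_mem {v : σ → K} {z : MvPolynomial σ K} {J : Ideal (MvPolynomial σ K)}
    (h : ∀ i, X i - C (v i) * z ∈ J) (f : MvPolynomial σ K) :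
    f - aeval (fun i => C (v i) * z) f ∈ J := by
  rw [← Ideal.Quotient.mk_eq_mk_iff_sub_mem]
  have : (Ideal.Quotient.mkₐ K J) =
      (Ideal.Quotient.mkₐ K J).comp (aeval (fun i => C (v i) * z)) := by
    ext i
    simpa using (Ideal.Quotient.mk_eq_mk_iff_sub_mem _ _).2 (h i)
  exact DFunLike.congr_fun this f

theorem lineIdeal_le {v : σ → K} {z : MvPolynomial σ K} {J : Ideal (MvPolynomial σ K)}
    (h : ∀ i, X i - C (v i) * z ∈ J) : lineIdeal v ≤ J := by
  intro f hf
  have h1 := sub_aeval_mem h f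
  have h2 := aeval_C_mul v z f
  rw [mem_lineIdeal.1 hf, map_zero] at h2
  rw [MvPolynomial.algebraMap_eq] at h2
  rwa [h2, sub_zero] at h1

theorem lineEval_of_isHomogeneous {v : σ → K} {f : MvPolynomial σ K} {d : ℕ}
    (hf : f.IsHomogeneous d) :
    lineEval v f = Polynomial.C (eval v f) * Polynomial.X ^ d := by
  rw [lineEval, aeval_def, eval₂_eq, eval_eq, map_sum, Finset.sum_mul]
  refine Finset.sum_congr rfl fun m hm => ?_
  simp only [mul_pow, Finset.prod_mul_distrib, Finset.prod_pow_eq_pow_sum, map_mul, map_prod,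
    map_pow, Polynomial.algebraMap_eq]
  rw [← hf (mem_support_iff.1 hm), Finsupp.weight_apply, Finsupp.sum]
  simp [mul_assoc]

theorem exists_linear_form {v : σ → K} (hv : v ≠ 0) :
    ∃ z : MvPolynomial σ K, z.IsHomogeneous 1 ∧ eval v z = 1 := by
  obtain ⟨i, hi⟩ := Function.ne_iff.1 hv
  refine ⟨C (v i)⁻¹ * X i, ?_, by simpa using inv_mul_cancel₀ hi⟩
  simpa using (isHomogeneous_C σ (v i)⁻¹).mul (isHomogeneous_X K i)

theorem X_sub_isHomogeneous (v : σ → K) {z : MvPolynomial σ K} (hz : z.IsHomogeneous 1) (i : σ) :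
    (X i - C (v i) * z).IsHomogeneous 1 := by
  refine (isHomogeneous_X K i).sub ?_
  simpa using (isHomogeneous_C σ (v i)).mul hz

theorem X_sub_mem_lineIdeal {v : σ → K} {z : MvPolynomial σ K} (hz : z.IsHomogeneous 1)
    (hz1 : eval v z = 1) (i : σ) : X i - C (v i) * z ∈ lineIdeal v := by
  rw [mem_lineIdeal, lineEval_of_isHomogeneous (X_sub_isHomogeneous v hz i)]
  simp [hz1]

theorem pointIdeal_eq_lineIdeal {N : ℕ} (q : ℙ K (Fin (N + 1) → K)) :
    pointIdeal q = lineIdeal q.rep := by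
  apply le_antisymm
  · rw [pointIdeal, Ideal.span_le]
    rintro f ⟨⟨d, hd⟩, hf⟩
    rw [SetLike.mem_coe, mem_lineIdeal, lineEval_of_isHomogeneous hd, hf]
    simp
  · obtain ⟨z, hz, hz1⟩ := exists_linear_form q.rep_nonzero
    refine lineIdeal_le (z := z) fun i => Ideal.subset_span ⟨⟨1, X_sub_isHomogeneous _ hz i⟩, ?_⟩
    simp [hz1]

theorem lineIdeal_smul {c : K} (hc : c ≠ 0) (v : σ → K) : lineIdeal (c • v) = lineIdeal v := by
  ext f
  have h : lineEval (c • v) f = (lineEval v f).comp (Polynomial.C c * Polynomial.X) := by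
    rw [Polynomial.comp_eq_aeval, ← aeval_C_mul, lineEval]
    congr 2
    ext1 i
    simp only [Pi.smul_apply, smul_eq_mul, map_mul, Polynomial.algebraMap_eq]
    ring
  rw [mem_lineIdeal, mem_lineIdeal, h]
  refine ⟨fun h0 => ?_, fun h0 => by simp [h0]⟩
  have h1 := congrArg (fun t => t.comp (Polynomial.C c⁻¹ * Polynomial.X)) h0
  simpa [Polynomial.comp_assoc, ← mul_assoc, ← Polynomial.C_mul, hc] using h1

theorem exists_order_hom {v : σ → K} (hv : v ≠ 0) :
    ∃ θ : MvPolynomial σ K →ₐ[K] Polynomial (MvPolynomial σ K),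
      ∀ m f, f ∈ lineIdeal v ^ m ↔ Polynomial.X ^ m ∣ θ f := by
  obtain ⟨z, hz, hz1⟩ := exists_linear_form hv
  set θ : MvPolynomial σ K →ₐ[K] Polynomial (MvPolynomial σ K) :=
    aeval fun i => Polynomial.C (C (v i) * z) +
      Polynomial.X * Polynomial.C (X i - C (v i) * z) with hθ
  have hrees : ∀ f, θ f ∈ reesAlgebra (lineIdeal v) := by
    intro f
    induction f using MvPolynomial.induction_on with
    | C a =>
      rw [hθ, ← MvPolynomial.algebraMap_eq, AlgHom.commutes]
      exact (reesAlgebra (lineIdeal v)).algebraMap_mem (C a)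
    | add f g hf hg => rw [map_add]; exact add_mem hf hg
    | mul_X f i hf =>
      rw [map_mul]
      refine mul_mem hf ?_
      rw [hθ, aeval_X]
      refine add_mem ((reesAlgebra (lineIdeal v)).algebraMap_mem _) ?_
      rw [mul_comm, ← pow_one Polynomial.X, Polynomial.C_mul_X_pow_eq_monomial]
      exact reesAlgebra.monomial_mem.2 (by simpa using X_sub_mem_lineIdeal hz hz1 i)
  have hone : ∀ f, (θ f).eval 1 = f := by
    intro f
    have : ((Polynomial.aeval (1 : MvPolynomial σ K)).restrictScalars K).comp θ =
        AlgHom.id K _ := by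
      ext i
      simp [hθ]
    simpa using DFunLike.congr_fun this f
  have hzero : ∀ f ∈ lineIdeal v, Polynomial.X ∣ θ f := by
    intro f hf
    rw [Polynomial.X_dvd_iff, Polynomial.coeff_zero_eq_eval_zero]
    have : ((Polynomial.aeval (0 : MvPolynomial σ K)).restrictScalars K).comp θ =
        aeval fun i => algebraMap K _ (v i) * z := by
      ext i
      simp [hθ]
    have h := DFunLike.congr_fun this f
    rw [aeval_C_mul, mem_lineIdeal.1 hf] at h
    simpa using h
  refine ⟨θ, fun m f => ⟨fun hf => ?_, fun hf => ?_⟩⟩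
  · have : lineIdeal v ^ m ≤ (Ideal.span {Polynomial.X ^ m}).comap θ := by
      rw [← Ideal.map_le_iff_le_comap, Ideal.map_pow, ← Ideal.span_singleton_pow]
      refine Ideal.pow_right_mono (Ideal.map_le_iff_le_comap.2 fun x hx => ?_) m
      exact Ideal.mem_span_singleton.2 (hzero x hx)
    exact Ideal.mem_span_singleton.1 (this hf)
  · rw [← hone f, Polynomial.eval_eq_sum_range]
    refine sum_mem fun k _ => ?_
    rw [one_pow, mul_one]
    by_cases hk : k < m
    · rw [Polynomial.X_pow_dvd_iff.1 hf k hk]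
      exact zero_mem _
    · exact Ideal.pow_le_pow_right (not_lt.1 hk) (hrees f k)

theorem mem_lineIdeal_pow_of_mul_mem {v : σ → K} (hv : v ≠ 0) {c f : MvPolynomial σ K} {m : ℕ}
    (hc : c ∉ lineIdeal v ^ 2) (h : c * f ∈ lineIdeal v ^ (m + 1)) : f ∈ lineIdeal v ^ m := by
  obtain ⟨θ, hθ⟩ := exists_order_hom hv
  rw [hθ] at *
  rw [map_mul] at h
  have hX : Prime (Polynomial.X : Polynomial (MvPolynomial σ K)) := Polynomial.prime_X
  by_cases h1 : Polynomial.X ∣ θ c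
  · obtain ⟨d, hd⟩ := h1
    rw [hd, pow_succ', mul_assoc, mul_dvd_mul_iff_left hX.ne_zero] at h
    refine hX.pow_dvd_of_dvd_mul_left m (fun h2 => hc ?_) h
    rw [hd, sq]
    exact mul_dvd_mul_left _ h2
  · exact (pow_dvd_pow _ m.le_succ).trans (hX.pow_dvd_of_dvd_mul_left _ h1 h)

theorem eval_pderiv_eq_zero {v : σ → K} {f : MvPolynomial σ K} (hf : f ∈ lineIdeal v ^ 2) (i : σ) :
    eval v (pderiv i f) = 0 := by
  have h0 : ∀ f ∈ lineIdeal v, eval v f = 0 := by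
    intro f hf
    have h := aeval_C_mul v (1 : K) f
    rw [mem_lineIdeal.1 hf] at h
    simpa [aeval_eq_eval] using h
  rw [sq] at hf
  induction hf using Submodule.mul_induction_on' with
  | mem_mul_mem a ha b hb => simp [Derivation.leibniz, h0 a ha, h0 b hb]
  | add a _ b _ iha ihb => simp [iha, ihb]

/-- Pullback of polynomials to the parameter line of the conic `x₀ x₂ = x₁²`. -/
def conicParam (K : Type*) [Field K] : MvPolynomial (Fin 3) K →ₐ[K] MvPolynomial (Fin 2) K :=
  aeval ![X 0 ^ 2, X 0 * X 1, X 1 ^ 2]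

/-- The point of the conic `x₀ x₂ = x₁²` with parameter `w`. -/
def conicPoint (w : Fin 2 → K) : Fin 3 → K :=
  ![w 0 ^ 2, w 0 * w 1, w 1 ^ 2]

/-- The linear form vanishing at `w`. -/
def rootForm (w : Fin 2 → K) : MvPolynomial (Fin 2) K :=
  C (w 1) * X 0 - C (w 0) * X 1

/-- The linear form defining the secant line of the conic through two of its points. -/
def secantForm (w w' : Fin 2 → K) : MvPolynomial (Fin 3) K :=
  C (w 1 * w' 1) * X 0 - C (w 0 * w' 1 + w 1 * w' 0) * X 1 + C (w 0 * w' 0) * X 2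

theorem conicParam_secantForm (w w' : Fin 2 → K) :
    conicParam K (secantForm w w') = rootForm w * rootForm w' := by
  simp [conicParam, secantForm, rootForm, MvPolynomial.algebraMap_eq]
  ring

theorem lineIdeal_eq_span_rootForm {w : Fin 2 → K} (hw : w ≠ 0) :
    lineIdeal w = Ideal.span {rootForm w} := by
  apply le_antisymm
  · by_cases h0 : w 0 = 0
    · have h1 : w 1 ≠ 0 := fun h1 => hw (by ext i; fin_cases i <;> simpa)
      refine lineIdeal_le (z := C (w 1)⁻¹ * X 1) fun i => Ideal.mem_span_singleton.2 ?_
      fin_cases i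
      · refine ⟨C (w 1)⁻¹, ?_⟩
        have : (C (w 1) * C (w 1)⁻¹ : MvPolynomial (Fin 2) K) = 1 := by
          rw [← C_mul, mul_inv_cancel₀ h1, C_1]
        simp only [rootForm, h0, C_0, Fin.zero_eta, Fin.isValue]
        linear_combination (-X 0) * this
      · simp [← mul_assoc, ← C_mul, h1]
    · refine lineIdeal_le (z := C (w 0)⁻¹ * X 0) fun i => Ideal.mem_span_singleton.2 ?_
      fin_cases i
      · simp [← mul_assoc, ← C_mul, h0]
      · refine ⟨-C (w 0)⁻¹, ?_⟩
        have : (C (w 0) * C (w 0)⁻¹ : MvPolynomial (Fin 2) K) = 1 := by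
          rw [← C_mul, mul_inv_cancel₀ h0, C_1]
        simp only [rootForm, Fin.mk_one, Fin.isValue]
        linear_combination (-X 1) * this
  · rw [Ideal.span_singleton_le_iff_mem, mem_lineIdeal]
    simp [lineEval, rootForm]
    ring

theorem rootForm_dvd_iff {w : Fin 2 → K} (hw : w ≠ 0) {f : MvPolynomial (Fin 2) K} :
    rootForm w ∣ f ↔ lineEval w f = 0 := by
  rw [← mem_lineIdeal, lineIdeal_eq_span_rootForm hw, Ideal.mem_span_singleton]

theorem rootForm_dvd_conicParam_iff {w : Fin 2 → K} (hw : w ≠ 0) {f : MvPolynomial (Fin 3) K} :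
    rootForm w ∣ conicParam K f ↔ f ∈ lineIdeal (conicPoint w) := by
  have h : (lineEval w).comp (conicParam K) =
      (Polynomial.expand K 2).comp (lineEval (conicPoint w)) := by
    ext1 i
    fin_cases i <;> simp [lineEval, conicParam, conicPoint] <;> ring
  rw [rootForm_dvd_iff hw, mem_lineIdeal, ← AlgHom.comp_apply, h, AlgHom.comp_apply,
    Polynomial.expand_eq_zero two_pos]

theorem prime_rootForm {w : Fin 2 → K} (hw : w ≠ 0) : Prime (rootForm w) := by
  have h0 : rootForm w ≠ 0 := by
    intro h
    apply hw
    have h1 := congrArg (eval ![1, 0]) h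
    have h2 := congrArg (eval ![0, 1]) h
    ext i
    fin_cases i
    · simpa [rootForm] using h2
    · simpa [rootForm] using h1
  rw [← Ideal.span_singleton_prime h0, ← lineIdeal_eq_span_rootForm hw]
  exact RingHom.ker_isPrime _

theorem isRelPrime_rootForm {w w' : Fin 2 → K} (h : w 0 * w' 1 ≠ w' 0 * w 1) :
    IsRelPrime (rootForm w) (rootForm w') := by
  have hw : w ≠ 0 := by rintro rfl; simp at h
  rw [(prime_rootForm hw).irreducible.isRelPrime_iff_not_dvd, rootForm_dvd_iff hw]
  intro h0
  apply h
  have h1 := congrArg (Polynomial.eval 1) h0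
  simp [lineEval, rootForm] at h1
  linear_combination h1

theorem conicParam_conic : conicParam K (X 0 * X 2 - X 1 ^ 2) = 0 := by
  simp [conicParam]
  ring

theorem exists_conic_normalForm (f : MvPolynomial (Fin 3) K) :
    ∃ a b : MvPolynomial (Fin 2) K, X 0 * X 2 - X 1 ^ 2 ∣
      f - (rename ![0, 2] a + X 1 * rename ![0, 2] b) := by
  induction f using MvPolynomial.induction_on with
  | C r => exact ⟨C r, 0, by simp⟩
  | add f g hf hg =>
    obtain ⟨a, b, h⟩ := hf
    obtain ⟨a', b', h'⟩ := hg
    refine ⟨a + a', b + b', ?_⟩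
    convert dvd_add h h' using 1
    simp only [map_add]
    ring
  | mul_X f i hf =>
    obtain ⟨a, b, q, h⟩ := hf
    rw [sub_eq_iff_eq_add] at h
    fin_cases i
    · refine ⟨X 0 * a, X 0 * b, q * X 0, ?_⟩
      simp [h]
      ring
    · refine ⟨X 0 * X 1 * b, a, q * X 1 - rename ![0, 2] b, ?_⟩
      simp [h]
      ring
    · refine ⟨X 1 * a, X 1 * b, q * X 2, ?_⟩
      simp [h]
      ring

theorem eq_zero_of_expand_add {a b : MvPolynomial (Fin 2) K}
    (h : expand 2 a + X 0 * X 1 * expand 2 b = 0) : a = 0 ∧ b = 0 := by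
  have ha : a = 0 := by
    ext m
    have h1 := congrArg (coeff (2 • m)) h
    rw [coeff_add, coeff_expand_smul 2 two_ne_zero, mul_assoc, coeff_X_mul'] at h1
    split_ifs at h1 with h2
    · rw [coeff_X_mul'] at h1
      split_ifs at h1 with h3
      · rw [coeff_expand_of_not_dvd (i := 0), add_zero] at h1
        · simpa using h1
        · simp at h2 ⊢
          omega
      · simpa using h1
    · simpa using h1
  refine ⟨ha, ?_⟩
  rw [ha, map_zero, zero_add] at h
  simpa [expand_eq_zero] using h

theorem conic_dvd_of_conicParam_eq_zero {f : MvPolynomial (Fin 3) K} (hf : conicParam K f = 0) :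
    X 0 * X 2 - X 1 ^ 2 ∣ f := by
  obtain ⟨a, b, h⟩ := exists_conic_normalForm f
  have hexp : (conicParam K).comp (rename ![0, 2]) = expand 2 := by
    ext1 i
    fin_cases i <;> simp [conicParam]
  have key := map_dvd (conicParam K) h
  have ha := DFunLike.congr_fun hexp a
  have hb := DFunLike.congr_fun hexp b
  rw [AlgHom.comp_apply] at ha hb
  have hX : conicParam K (X 1) = X 0 * X 1 := by simp [conicParam]
  rw [conicParam_conic, zero_dvd_iff, map_sub, hf, zero_sub, neg_eq_zero, map_add, map_mul, ha, hb,
    hX] at key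
  obtain ⟨rfl, rfl⟩ := eq_zero_of_expand_add key
  simpa using h

theorem conic_notMem_lineIdeal_sq {w : Fin 2 → K} (hw : w ≠ 0) :
    X 0 * X 2 - X 1 ^ 2 ∉ lineIdeal (conicPoint w) ^ 2 := by
  intro h
  apply hw
  have h0 := eval_pderiv_eq_zero h 0
  have h2 := eval_pderiv_eq_zero h 2
  simp [conicPoint, pderiv_X, Derivation.leibniz, Derivation.leibniz_pow] at h0 h2
  ext i
  fin_cases i <;> simpa

attribute [local instance] weightedGradedAlgebra

theorem mem_range_conicParam_iff {f : MvPolynomial (Fin 2) K} :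
    f ∈ (conicParam K).range ↔ f ∈ weightedHomogeneousSubmodule K (fun _ => (1 : ZMod 2)) 0 := by
  have hX (i : Fin 2) : X i ∈ weightedHomogeneousSubmodule K (fun _ => (1 : ZMod 2)) 1 :=
    isWeightedHomogeneous_X K _ i
  constructor
  · rintro ⟨f, rfl⟩
    change conicParam K f ∈ _
    induction f using MvPolynomial.induction_on with
    | C r =>
      rw [← MvPolynomial.algebraMap_eq, AlgHom.commutes]
      exact isWeightedHomogeneous_C _ _
    | add f g hf hg => rw [map_add]; exact add_mem hf hg
    | mul_X f i hf =>
      rw [map_mul]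
      refine add_zero (0 : ZMod 2) ▸ SetLike.mul_mem_graded hf ?_
      have h2 : (0 : ZMod 2) = 1 + 1 := by decide
      rw [h2]
      fin_cases i <;> simp [conicParam, sq] <;> exact SetLike.mul_mem_graded (hX _) (hX _)
  · intro hf
    rw [f.as_sum]
    refine sum_mem fun m hm => ?_
    have h1 := hf (mem_support_iff.1 hm)
    have h2 : Even (m 0 + m 1) := by
      rw [← ZMod.natCast_eq_zero_iff_even, ← h1, Finsupp.weight_apply, Finsupp.sum_fintype] <;> simp
    have h3 : monomial m (coeff m f) = coeff m f • (X 0 ^ m 0 * X 1 ^ m 1) := by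
      rw [monomial_eq, Finsupp.prod_fintype] <;> simp [smul_eq_C_mul]
    rw [h3]
    refine Subalgebra.smul_mem _ ?_ _
    have e0 : X 0 ^ 2 ∈ (conicParam K).range := ⟨X 0, by simp [conicParam]⟩
    have e1 : X 0 * X 1 ∈ (conicParam K).range := ⟨X 1, by simp [conicParam]⟩
    have e2 : X 1 ^ 2 ∈ (conicParam K).range := ⟨X 2, by simp [conicParam]⟩
    rcases Nat.even_or_odd' (m 0) with ⟨i, hi | hi⟩ <;>
      rcases Nat.even_or_odd' (m 1) with ⟨j, hj | hj⟩ <;> rw [hi, hj] at h2 ⊢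
    · rw [pow_mul, pow_mul]
      exact mul_mem (pow_mem e0 i) (pow_mem e2 j)
    · exact absurd h2 (by grind)
    · exact absurd h2 (by grind)
    · convert mul_mem (mul_mem (pow_mem e0 i) (pow_mem e2 j)) e1 using 1
      ring

theorem mem_range_conicParam_of_mul_mem {g h : MvPolynomial (Fin 2) K} (hg0 : g ≠ 0)
    (hg : g ∈ (conicParam K).range) (hgh : g * h ∈ (conicParam K).range) :
    h ∈ (conicParam K).range := by
  classical
  rw [mem_range_conicParam_iff] at *
  set 𝒜 := weightedHomogeneousSubmodule K (fun _ : Fin 2 => (1 : ZMod 2))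
  have h1 := DirectSum.coe_decompose_mul_of_left_mem_zero 𝒜 (j := 1) (b := h) hg
  rw [DirectSum.decompose_of_mem_ne 𝒜 hgh (by decide)] at h1
  have h2 : (DirectSum.decompose 𝒜 h 1 : MvPolynomial (Fin 2) K) = 0 := by
    simpa [hg0] using h1.symm
  have h3 := DirectSum.sum_support_decompose 𝒜 h
  rw [← h3]
  refine sum_mem fun i _ => ?_
  obtain rfl | rfl : i = 0 ∨ i = 1 := by
    generalize i = k
    revert k
    decide
  · exact SetLike.coe_mem _
  · rw [h2]; exact zero_mem _

theorem symbolic_powers_conicPoint (w : Fin 5 → Fin 2 → K)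
    (hw : ∀ i j, i ≠ j → w i 0 * w j 1 ≠ w j 0 * w i 1) (r : ℕ) :
    (⨅ i, lineIdeal (conicPoint (w i)) ^ (2 * r)) =
        (⨅ i, lineIdeal (conicPoint (w i)) ^ 2) ^ r ∧
      (⨅ i, lineIdeal (conicPoint (w i)) ^ (2 * r + 1)) =
        (⨅ i, lineIdeal (conicPoint (w i)) ^ (2 * r)) * (⨅ i, lineIdeal (conicPoint (w i))) := by
  have hw0 : ∀ i, w i ≠ 0 := by
    intro i h
    have := hw i (i + 1) (by simp)
    simp [h] at this
  have hv0 : ∀ i, conicPoint (w i) ≠ 0 := by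
    intro i h
    apply hw0 i
    ext j
    have h0 := congrFun h 0
    have h2 := congrFun h 2
    simp [conicPoint] at h0 h2
    fin_cases j <;> simpa
  set g := ∏ i, rootForm (w i) with hg
  have hg0 : g ≠ 0 := Finset.prod_ne_zero_iff.2 fun i _ => (prime_rootForm (hw0 i)).ne_zero
  have hdvd : ∀ m, ∀ f ∈ ⨅ i, lineIdeal (conicPoint (w i)) ^ m, g ^ m ∣ conicParam K f := by
    intro m f hf
    rw [Ideal.mem_iInf] at hf
    rw [hg, ← Finset.prod_pow]
    refine Finset.prod_dvd_of_isRelPrime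
      (fun i _ j _ hij => (isRelPrime_rootForm (hw i j hij)).pow) fun i _ => ?_
    rw [← Ideal.mem_span_singleton, ← Ideal.span_singleton_pow, ← Ideal.mem_comap]
    refine Ideal.le_comap_pow _ m (Ideal.pow_right_mono (fun x hx => ?_) m (hf i))
    rw [Ideal.mem_comap, Ideal.mem_span_singleton]
    exact (rootForm_dvd_conicParam_iff (hw0 i)).2 hx
  have hsec (i j) : secantForm (w i) (w j) ∈ lineIdeal (conicPoint (w i)) ∧
      secantForm (w i) (w j) ∈ lineIdeal (conicPoint (w j)) := by
    rw [← rootForm_dvd_conicParam_iff (hw0 i), ← rootForm_dvd_conicParam_iff (hw0 j),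
      conicParam_secantForm]
    exact ⟨dvd_mul_right _ _, dvd_mul_left _ _⟩
  have hφq : conicParam K (∏ i, secantForm (w i) (w (i + 1))) = g ^ 2 := by
    rw [map_prod]
    simp only [conicParam_secantForm, Finset.prod_mul_distrib]
    rw [sq, hg]
    exact congrArg _ (Equiv.prod_comp (Equiv.addRight (1 : Fin 5)) fun i => rootForm (w i))
  have hker : ∀ f, conicParam K f = 0 → X 0 * X 2 - X 1 ^ 2 ∣ f :=
    fun f => conic_dvd_of_conicParam_eq_zero
  have hrange : ∀ h, g ^ 2 * h ∈ (conicParam K : MvPolynomial (Fin 3) K →+* _).range →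
      h ∈ (conicParam K : MvPolynomial (Fin 3) K →+* _).range :=
    fun h => mem_range_conicParam_of_mul_mem (pow_ne_zero 2 hg0) ⟨_, hφq⟩
  have hmem : ∀ f, g ∣ conicParam K f → f ∈ ⨅ i, lineIdeal (conicPoint (w i)) := by
    intro f hf
    rw [Ideal.mem_iInf]
    intro i
    rw [← rootForm_dvd_conicParam_iff (hw0 i)]
    exact (Finset.dvd_prod_of_mem (fun i => rootForm (w i)) (Finset.mem_univ i)).trans hf
  refine symbolic_powers_of_section (conicParam K : MvPolynomial (Fin 3) K →+* _)
    _ _ g (fun i => lineIdeal (conicPoint (w i))) conicParam_conic hker hdvd hmem ?_ ?_ hφq hrange r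
  · intro m f hf
    rw [Ideal.mem_iInf] at hf ⊢
    exact fun i => mem_lineIdeal_pow_of_mul_mem (hv0 i) (conic_notMem_lineIdeal_sq (hw0 i)) (hf i)
  · rw [Ideal.mem_iInf]
    intro i
    have hi : i - 1 ≠ i := by simp
    rw [← Finset.mul_prod_erase _ _ (Finset.mem_univ i), ← Finset.mul_prod_erase _ _
      (Finset.mem_erase.2 ⟨hi, Finset.mem_univ (i - 1)⟩), ← mul_assoc, sq]
    refine Ideal.mul_mem_right _ _ (Ideal.mul_mem_mul (hsec _ _).1 ?_)
    simpa using (hsec (i - 1) (i - 1 + 1)).2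

/-- The linear change of coordinates with matrix `M`. -/
def linearSubst {n : ℕ} (M : Matrix (Fin n) (Fin n) K) :
    MvPolynomial (Fin n) K →ₐ[K] MvPolynomial (Fin n) K :=
  aeval fun k => ∑ j, C (M k j) * X j

theorem linearSubst_comp {n : ℕ} (M N : Matrix (Fin n) (Fin n) K) :
    (linearSubst M).comp (linearSubst N) = linearSubst (N * M) := by
  ext1 k
  simp only [linearSubst, AlgHom.comp_apply, aeval_X, map_sum, map_mul, algHom_C,
    MvPolynomial.algebraMap_eq, Matrix.mul_apply, Finset.mul_sum, Finset.sum_mul]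
  rw [Finset.sum_comm]
  simp only [mul_assoc]

theorem linearSubst_one {n : ℕ} :
    linearSubst (1 : Matrix (Fin n) (Fin n) K) = AlgHom.id K _ := by
  ext1 k
  simp [linearSubst, Matrix.one_apply, apply_ite C, ite_mul]

theorem lineIdeal_mulVec {n : ℕ} (M : Matrix (Fin n) (Fin n) K) (v : Fin n → K) :
    lineIdeal (M.mulVec v) = (lineIdeal v).comap (linearSubst M) := by
  have h : (lineEval v).comp (linearSubst M) = lineEval (M.mulVec v) := by
    ext1 k
    simp [linearSubst, lineEval, Matrix.mulVec, dotProduct, Finset.sum_mul, mul_assoc]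
  ext f
  rw [Ideal.mem_comap, mem_lineIdeal, mem_lineIdeal, ← h, AlgHom.comp_apply]

theorem iInf_comap_pow {R S ι : Type*} [CommRing R] [CommRing S] (e : R ≃+* S)
    (P : ι → Ideal S) (m : ℕ) :
    (⨅ i, (P i).comap e ^ m) = (⨅ i, P i ^ m).comap e := by
  rw [Ideal.comap_iInf]
  refine iInf_congr fun i => ?_
  rw [← Ideal.map_symm, ← Ideal.map_symm, Ideal.map_pow]

theorem symbolic_powers_of_eq_mulVec (v : Fin 5 → Fin 3 → K) (w : Fin 5 → Fin 2 → K)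
    (M : Matrix (Fin 3) (Fin 3) K) (hM : M.det ≠ 0)
    (hw : ∀ i j, i ≠ j → w i 0 * w j 1 ≠ w j 0 * w i 1)
    (hv : ∀ i, ∃ t : K, t ≠ 0 ∧ t • v i = M.mulVec (conicPoint (w i))) (r : ℕ) :
    (⨅ i, lineIdeal (v i) ^ (2 * r)) = (⨅ i, lineIdeal (v i) ^ 2) ^ r ∧
      (⨅ i, lineIdeal (v i) ^ (2 * r + 1)) =
        (⨅ i, lineIdeal (v i) ^ (2 * r)) * (⨅ i, lineIdeal (v i)) := by
  have hu : IsUnit M.det := hM.isUnit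
  set e : MvPolynomial (Fin 3) K ≃+* MvPolynomial (Fin 3) K :=
    (AlgEquiv.ofAlgHom (linearSubst M) (linearSubst M⁻¹)
      (by rw [linearSubst_comp, Matrix.nonsing_inv_mul _ hu, linearSubst_one])
      (by rw [linearSubst_comp, Matrix.mul_nonsing_inv _ hu, linearSubst_one])).toRingEquiv with he
  have hP : ∀ i, lineIdeal (v i) = (lineIdeal (conicPoint (w i))).comap e := by
    intro i
    obtain ⟨t, ht, h⟩ := hv i
    rw [← lineIdeal_smul ht, h, lineIdeal_mulVec]
    rfl
  have h1 := iInf_comap_pow e (fun i => lineIdeal (conicPoint (w i))) 1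
  simp only [pow_one] at h1
  obtain ⟨ha, hb⟩ := symbolic_powers_conicPoint w hw r
  simp only [hP, iInf_comap_pow, h1, ha, hb]
  simp only [← Ideal.map_symm, Ideal.map_pow, Ideal.map_mul, and_self]

/-- The determinant of three vectors in three-space. -/
def tripleDet {A : Type*} [CommRing A] (a b c : Fin 3 → A) : A :=
  a 0 * (b 1 * c 2 - b 2 * c 1) - a 1 * (b 0 * c 2 - b 2 * c 0) + a 2 * (b 0 * c 1 - b 1 * c 0)

theorem exists_conicPoint_of_frame (B : Matrix (Fin 3) (Fin 3) K) (hB : B.det ≠ 0)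
    (c d : Fin 3 → K) (hc : ∀ k, c k ≠ 0) (hd : ∀ k, d k ≠ 0)
    (hcd : ∀ i j, i ≠ j → c i * d j ≠ c j * d i) :
    ∃ (M : Matrix (Fin 3) (Fin 3) K) (w : Fin 5 → Fin 2 → K) (t : Fin 5 → K),
      M.det ≠ 0 ∧ (∀ i j, i ≠ j → w i 0 * w j 1 ≠ w j 0 * w i 1) ∧ (∀ i, t i ≠ 0) ∧
      M.mulVec (conicPoint (w 0)) = t 0 • B.col 0 ∧ M.mulVec (conicPoint (w 1)) = t 1 • B.col 1 ∧
      M.mulVec (conicPoint (w 2)) = t 2 • B.col 2 ∧ M.mulVec (conicPoint (w 3)) = t 3 • B.mulVec c ∧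
      M.mulVec (conicPoint (w 4)) = t 4 • B.mulVec d := by
  have h01 := sub_ne_zero.2 (hcd 0 1 (by decide))
  have h02 := sub_ne_zero.2 (hcd 0 2 (by decide))
  have h12 := sub_ne_zero.2 (hcd 1 2 (by decide))
  have hc0 := hc 0
  have hc1 := hc 1
  have hc2 := hc 2
  have hd0 := hd 0
  have hd1 := hd 1
  have hd2 := hd 2
  set N : Matrix (Fin 3) (Fin 3) K :=
    !![c 0 * d 0 * (d 1 * d 2), c 0 * d 0 * (d 1 * c 2 + d 2 * c 1), c 0 * d 0 * (c 1 * c 2);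
       c 1 * d 1 * (d 0 * d 2), c 1 * d 1 * (d 0 * c 2 + d 2 * c 0), c 1 * d 1 * (c 0 * c 2);
       c 2 * d 2 * (d 0 * d 1), c 2 * d 2 * (d 0 * c 1 + d 1 * c 0), c 2 * d 2 * (c 0 * c 1)] with hN
  have hNdet : N.det = c 0 * d 0 * (c 1 * d 1) * (c 2 * d 2) * ((c 0 * d 1 - c 1 * d 0) *
      (c 0 * d 2 - c 2 * d 0) * (c 1 * d 2 - c 2 * d 1)) := by
    rw [hN, Matrix.det_fin_three]
    simp
    ring
  have key : ∀ (x : Fin 2 → K) (s : K) (y : Fin 3 → K), N.mulVec (conicPoint x) = s • y →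
      (B * N).mulVec (conicPoint x) = s • B.mulVec y := by
    intro x s y h
    rw [← Matrix.mulVec_mulVec, h, Matrix.mulVec_smul]
  have hcol : ∀ k, B.col k = B.mulVec (Pi.single k 1) := fun k => by simp
  refine ⟨B * N, ![![c 0, -d 0], ![c 1, -d 1], ![c 2, -d 2], ![1, 0], ![0, 1]],
    ![c 0 * d 0 * ((c 0 * d 1 - c 1 * d 0) * (c 0 * d 2 - c 2 * d 0)),
      -(c 1 * d 1 * ((c 0 * d 1 - c 1 * d 0) * (c 1 * d 2 - c 2 * d 1))),
      c 2 * d 2 * ((c 0 * d 2 - c 2 * d 0) * (c 1 * d 2 - c 2 * d 1)),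
      d 0 * d 1 * d 2, c 0 * c 1 * c 2], ?_, ?_, ?_, ?_, ?_, ?_, ?_, ?_⟩
  · rw [Matrix.det_mul, hNdet]
    simp [*]
  · intro i j hij
    fin_cases i <;> fin_cases j <;> simp at hij ⊢ <;> first | assumption | grind
  · intro i
    fin_cases i <;> simp [*]
  all_goals
    try rw [hcol]
    apply key
    ext k
    fin_cases k <;> simp [hN, conicPoint, Matrix.mulVec, dotProduct, Fin.sum_univ_three] <;> ring

theorem symbolic_powers_of_tripleDet_ne_zero (v : Fin 5 → Fin 3 → K)
    (hv : ∀ i j k, i ≠ j → j ≠ k → i ≠ k → tripleDet (v i) (v j) (v k) ≠ 0) (r : ℕ) :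
    (⨅ i, lineIdeal (v i) ^ (2 * r)) = (⨅ i, lineIdeal (v i) ^ 2) ^ r ∧
      (⨅ i, lineIdeal (v i) ^ (2 * r + 1)) =
        (⨅ i, lineIdeal (v i) ^ (2 * r)) * (⨅ i, lineIdeal (v i)) := by
  set B : Matrix (Fin 3) (Fin 3) K := Matrix.of fun a k => ![v 0, v 1, v 2] k a with hB
  have hδ := hv 0 1 2 (by decide) (by decide) (by decide)
  set δ := tripleDet (v 0) (v 1) (v 2) with hδ_def
  have hdet : B.det = δ := by
    simp [hB, hδ_def, tripleDet, Matrix.det_fin_three]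
    ring
  let coord (x : Fin 3 → K) : Fin 3 → K :=
    ![tripleDet x (v 1) (v 2), tripleDet (v 0) x (v 2), tripleDet (v 0) (v 1) x]
  have hcoord : ∀ x, B.mulVec (coord x) = δ • x := by
    intro x
    ext a
    fin_cases a <;>
      simp [hB, coord, hδ_def, tripleDet, Matrix.mulVec, dotProduct, Fin.sum_univ_three] <;> ring
  have hne : ∀ i, i = 3 ∨ i = 4 → ∀ k, coord (v i) k ≠ 0 := by
    rintro i (rfl | rfl) k <;> fin_cases k <;>
      exact hv _ _ _ (by decide) (by decide) (by decide)
  have hminor : ∀ i j, i ≠ j →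
      coord (v 3) i * coord (v 4) j ≠ coord (v 3) j * coord (v 4) i := by
    have h01 : coord (v 3) 0 * coord (v 4) 1 - coord (v 3) 1 * coord (v 4) 0 =
        δ * tripleDet (v 3) (v 4) (v 2) := by simp [coord, hδ_def, tripleDet]; ring
    have h02 : coord (v 3) 0 * coord (v 4) 2 - coord (v 3) 2 * coord (v 4) 0 =
        δ * tripleDet (v 3) (v 1) (v 4) := by simp [coord, hδ_def, tripleDet]; ring
    have h12 : coord (v 3) 1 * coord (v 4) 2 - coord (v 3) 2 * coord (v 4) 1 =
        δ * tripleDet (v 0) (v 3) (v 4) := by simp [coord, hδ_def, tripleDet]; ring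
    have g01 := h01 ▸ mul_ne_zero hδ (hv 3 4 2 (by decide) (by decide) (by decide))
    have g02 := h02 ▸ mul_ne_zero hδ (hv 3 1 4 (by decide) (by decide) (by decide))
    have g12 := h12 ▸ mul_ne_zero hδ (hv 0 3 4 (by decide) (by decide) (by decide))
    rw [sub_ne_zero] at g01 g02 g12
    intro i j hij
    fin_cases i <;> fin_cases j <;>
      first | exact absurd rfl hij | assumption | exact Ne.symm ‹_›
  obtain ⟨M, w, t, hM, hw, ht, h0, h1, h2, h3, h4⟩ := exists_conicPoint_of_frame B (hdet ▸ hδ)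
    (coord (v 3)) (coord (v 4)) (hne 3 (by simp)) (hne 4 (by simp)) hminor
  rw [hcoord, smul_smul] at h3 h4
  refine symbolic_powers_of_eq_mulVec v w M hM hw (fun i => ?_) r
  fin_cases i
  · exact ⟨t 0, ht 0, h0.symm⟩
  · exact ⟨t 1, ht 1, h1.symm⟩
  · exact ⟨t 2, ht 2, h2.symm⟩
  · exact ⟨_, mul_ne_zero (ht 3) hδ, h3.symm⟩
  · exact ⟨_, mul_ne_zero (ht 4) hδ, h4.symm⟩

/-- The product of all determinants of triples of distinct points among five points. -/
def generalPositionPoly (K : Type*) [Field K] : MvPolynomial (Fin 5 × Fin 3) K :=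
  ∏ t : Fin 5 × Fin 5 × Fin 5 with t.1 ≠ t.2.1 ∧ t.2.1 ≠ t.2.2 ∧ t.1 ≠ t.2.2,
    tripleDet (fun a => X (t.1, a)) (fun a => X (t.2.1, a)) (fun a => X (t.2.2, a))

theorem eval_generalPositionPoly_ne_zero_iff (v : Fin 5 → Fin 3 → K) :
    eval (fun x => v x.1 x.2) (generalPositionPoly K) ≠ 0 ↔
      ∀ i j k, i ≠ j → j ≠ k → i ≠ k → tripleDet (v i) (v j) (v k) ≠ 0 := by
  simp only [generalPositionPoly, map_prod, Finset.prod_ne_zero_iff, Finset.mem_filter,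
    Finset.mem_univ, true_and, Prod.forall, and_imp]
  simp [tripleDet]

theorem isWeightedHomogeneous_generalPositionPoly {M : Type*} [AddCommMonoid M] (w : Fin 5 → M) :
    ∃ d, (generalPositionPoly K).IsWeightedHomogeneous (fun x => w x.1) d := by
  refine ⟨_, IsWeightedHomogeneous.prod _ _ (fun t => w t.1 + (w t.2.1 + w t.2.2)) fun t _ => ?_⟩
  have hX (i : Fin 5) (a : Fin 3) :
      (X (i, a) : MvPolynomial (Fin 5 × Fin 3) K).IsWeightedHomogeneous (fun x => w x.1) (w i) :=
    isWeightedHomogeneous_X K _ (i, a)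
  have hXX (i j k : Fin 5) (a b c : Fin 3) := (hX i a).mul ((hX j b).mul (hX k c))
  simp only [tripleDet, mul_sub, ← mem_weightedHomogeneousSubmodule] at hXX ⊢
  exact add_mem (sub_mem (sub_mem (hXX ..) (hXX ..)) (sub_mem (hXX ..) (hXX ..)))
    (sub_mem (hXX ..) (hXX ..))

theorem exists_eval_generalPositionPoly_ne_zero [Infinite K] :
    ∃ p : Fin 5 → ℙ K (Fin 3 → K),
      eval (fun x => (p x.1).rep x.2) (generalPositionPoly K) ≠ 0 := by
  let s : Fin 5 → K := fun i => Infinite.natEmbedding K i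
  have hs : ∀ i j, i ≠ j → s i - s j ≠ 0 := fun i j hij =>
    sub_ne_zero.2 fun h => hij (Fin.ext ((Infinite.natEmbedding K).injective h))
  have hv : ∀ i, (![1, s i, s i ^ 2] : Fin 3 → K) ≠ 0 := fun i h => by
    simpa using congrFun h 0
  refine ⟨fun i => Projectivization.mk K _ (hv i),
    (eval_generalPositionPoly_ne_zero_iff fun i => (Projectivization.mk K _ (hv i)).rep).2 ?_⟩
  intro i j k hij hjk hik
  obtain ⟨a, ha⟩ := Projectivization.exists_smul_eq_mk_rep K _ (hv i)
  obtain ⟨b, hb⟩ := Projectivization.exists_smul_eq_mk_rep K _ (hv j)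
  obtain ⟨c, hc⟩ := Projectivization.exists_smul_eq_mk_rep K _ (hv k)
  rw [← ha, ← hb, ← hc]
  have h : tripleDet (a • ![1, s i, s i ^ 2]) (b • ![1, s j, s j ^ 2]) (c • ![1, s k, s k ^ 2]) =
      -(a * b * c * ((s i - s j) * (s j - s k) * (s i - s k)) : K) := by
    simp [tripleDet, Units.smul_def]
    ring
  rw [h]
  simp [hs i j hij, hs j k hjk, hs i k hik]

end LineIdeal

/-- there is a nonempty Zariski-open subset `U` of `(ℙ²)⁵` (the complement
of the common zero locus of a set `G` of multihomogeneous polynomials in the `5` triples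
of coordinates) such that every tuple of pairwise distinct points in `U` has radical
ideal `I` satisfying `I^(2r) = (I^(2))^r` and `I^(2r+1) = I^(2r)·I` for all `r ≥ 1`. -/
theorem stmt13 {K : Type*} [Field K] [IsAlgClosed K] :
    ∃ G : Set (MvPolynomial (Fin 5 × Fin (2 + 1)) K),
      (∀ g ∈ G, ∀ i : Fin 5, ∃ d : ℕ,
        g.IsWeightedHomogeneous (fun v => if v.1 = i then 1 else 0) d) ∧
      (∃ p : Fin 5 → ℙ K (Fin (2 + 1) → K),
        ∃ g ∈ G, MvPolynomial.eval (fun v => (p v.1).rep v.2) g ≠ 0) ∧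
      (∀ p : Fin 5 → ℙ K (Fin (2 + 1) → K), Function.Injective p →
        (∃ g ∈ G, MvPolynomial.eval (fun v => (p v.1).rep v.2) g ≠ 0) →
        ∀ r : ℕ, 1 ≤ r →
          (⨅ i, (pointIdeal (p i)) ^ (2 * r)) = (⨅ i, (pointIdeal (p i)) ^ 2) ^ r ∧
          (⨅ i, (pointIdeal (p i)) ^ (2 * r + 1)) =
            (⨅ i, (pointIdeal (p i)) ^ (2 * r)) * (⨅ i, pointIdeal (p i))) := by
  have : Infinite K := IsAlgClosed.instInfinite
  refine ⟨{generalPositionPoly K}, ?_, ?_, ?_⟩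
  · rintro g rfl i
    exact isWeightedHomogeneous_generalPositionPoly fun j => if j = i then 1 else 0
  · obtain ⟨p, hp⟩ := exists_eval_generalPositionPoly_ne_zero (K := K)
    exact ⟨p, _, rfl, hp⟩
  · rintro p - ⟨g, rfl, hg⟩ r -
    simp only [pointIdeal_eq_lineIdeal]
    exact symbolic_powers_of_tripleDet_ne_zero (fun i => (p i).rep)
      ((eval_generalPositionPoly_ne_zero_iff fun i => (p i).rep).1 hg) r

end
end

section
/- Let g > 0 and r > 0 be integers and let J_1,...,J_s be ideals of a polynomial ring R over a field K, each generated by at most g elements. Assume either that each J_i is a monomial ideal, or that char(K) = p > 0 and r is a power of p. Then ∩_i (J_i^m) ⊆ (∩_i J_i)^r whenever m ≥ gr - g + 1. -/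
open MvPolynomial
open scoped LinearAlgebra.Projectivization

noncomputable section

/-- A monomial ideal: an ideal generated by monomials. -/
def IsMonomialIdeal {σ K : Type*} [CommSemiring K] (J : Ideal (MvPolynomial σ K)) : Prop :=
  ∃ S : Set (σ →₀ ℕ), J = Ideal.span ((fun d => (MvPolynomial.monomial d (1 : K))) '' S)

open Finset in
/-- If `s` has at most `g` elements then any product of more than `g * (r - 1)` of them is divisible
by an `r`-th power of one of them. -/
theorem Ideal.span_finset_pow_le_span_image_pow {R : Type*} [CommSemiring R] {g r m : ℕ}
    (hr : 0 < r) (hm : g * r - g + 1 ≤ m) (s : Finset R) (hs : s.card ≤ g) :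
    Ideal.span (s : Set R) ^ m ≤ Ideal.span ((fun x => x ^ r) '' (s : Set R)) := by
  classical
  rw [Ideal.span, Submodule.span_pow, Submodule.span_le]
  intro a ha
  obtain ⟨f, hf, rfl⟩ := Set.mem_pow_iff_prod.1 ha
  obtain ⟨n, rfl⟩ : ∃ n, r = n + 1 := ⟨r - 1, by omega⟩
  have hgm : g * n < m := by
    rw [mul_add, mul_one, Nat.add_sub_cancel] at hm
    omega
  have hcard : #s * n < #(Finset.univ : Finset (Fin m)) := by
    simpa using (Nat.mul_le_mul_right n hs).trans_lt hgm
  obtain ⟨y, hy, hlt⟩ := exists_lt_card_fiber_of_mul_lt_card_of_maps_to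
    (fun i _ => hf i) hcard
  refine Ideal.mem_of_dvd _ ?_ (Ideal.subset_span ⟨y, hy, rfl⟩)
  have hfib : ∏ i with f i = y, f i = y ^ #{i | f i = y} :=
    Finset.prod_eq_pow_card fun i hi => (Finset.mem_filter.1 hi).2
  calc y ^ (n + 1) ∣ y ^ #{i | f i = y} := pow_dvd_pow y hlt
    _ ∣ ∏ i, f i := hfib ▸ Finset.prod_dvd_prod_of_subset _ _ _ (Finset.filter_subset _ _)

/-- If every element of `B` is generated by the images of its coordinates under `F`-semilinear
projections `B → A`, then extension of ideals along `F` commutes with intersections. -/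
theorem Ideal.iInf_map_le_map_iInf_of_retractions {A B ι : Type*} [CommSemiring A] [CommSemiring B]
    (F : A →+* B)
    (hF : ∀ f : B, f ∈ Ideal.span
      {y | ∃ φ : B →+ A, (∀ a b, φ (F a * b) = a * φ b) ∧ y = F (φ f)})
    (J : ι → Ideal A) : ⨅ i, (J i).map F ≤ (⨅ i, J i).map F := by
  intro f hf
  refine Ideal.span_le.2 ?_ (hF f)
  rintro _ ⟨φ, hφ, rfl⟩
  refine Ideal.mem_map_of_mem F ((Ideal.mem_iInf).2 fun i => ?_)
  have hfi : f ∈ (J i).map F := Ideal.mem_iInf.1 hf i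
  clear hf
  have key : ∀ x ∈ (J i).map F, φ x ∈ J i := by
    intro x hx
    refine Submodule.closure_induction ?_ ?_ ?_ hx
    · simp
    · intro x y _ _ hx hy
      rw [map_add]
      exact add_mem hx hy
    · rintro b _ ⟨a, ha, rfl⟩
      rw [smul_eq_mul, mul_comm, hφ]
      exact (J i).mul_mem_right _ ha
  exact key f hfi

namespace MvPolynomial

section Frobenius

variable {σ K L : Type*} [CommSemiring K] [CommSemiring L]

/-- For an additive map `l : L → K`, sends `a x^d` to `l a x^((d - c) / q)` if `d ≡ c` modulo `q`,
and to `0` otherwise; here `c` is a vector of residues modulo `q`. -/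
def residuePart (q : ℕ) (c : σ →₀ ℕ) (l : L →+ K) : MvPolynomial σ L →+ MvPolynomial σ K :=
  open Classical in
  (Finsupp.liftAddHom fun d : σ →₀ ℕ =>
    if d.mapRange (· % q) (Nat.zero_mod q) = c then
      (monomial (d.mapRange (· / q) (Nat.zero_div q)) :
        K →ₗ[K] MvPolynomial σ K).toAddMonoidHom.comp l
    else 0).comp (basisMonomials σ L).repr.toLinearMap.toAddMonoidHom

open Classical in
theorem residuePart_monomial (q : ℕ) (c : σ →₀ ℕ) (l : L →+ K) (d : σ →₀ ℕ) (a : L) :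
    residuePart q c l (monomial d a) =
      if d.mapRange (· % q) (Nat.zero_mod q) = c then
        monomial (d.mapRange (· / q) (Nat.zero_div q)) (l a) else 0 := by
  have h : (basisMonomials σ L).repr (monomial d a) = Finsupp.single d a := by
    ext
    simp [basisMonomials]
    rfl
  simp only [residuePart, AddMonoidHom.comp_apply, LinearMap.toAddMonoidHom_coe,
    LinearEquiv.coe_coe, h, Finsupp.liftAddHom_apply_single]
  split_ifs <;> simp

theorem residuePart_expand_map_mul {q : ℕ} (hq : 0 < q) (c : σ →₀ ℕ) (θ : K →+* L) (l : L →+ K)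
    (hl : ∀ a b, l (θ a * b) = a * l b) (f : MvPolynomial σ K) (h : MvPolynomial σ L) :
    residuePart q c l (expand q (map θ f) * h) = f * residuePart q c l h := by
  induction f using induction_on' with
  | add f₁ f₂ h₁ h₂ => simp only [map_add, add_mul, h₁, h₂]
  | monomial e a =>
    induction h using induction_on' with
    | add f₁ f₂ h₁ h₂ => simp only [map_add, mul_add, h₁, h₂]
    | monomial d b =>
      have hmod : (q • e + d).mapRange (· % q) (Nat.zero_mod q)
          = d.mapRange (· % q) (Nat.zero_mod q) := by
        ext x
        simp
      have hdiv : (q • e + d).mapRange (· / q) (Nat.zero_div q)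
          = e + d.mapRange (· / q) (Nat.zero_div q) := by
        ext x
        simp [Nat.mul_add_div hq]
      rw [map_monomial, expand_monomial, monomial_mul, residuePart_monomial, residuePart_monomial,
        hmod, hdiv, hl]
      split_ifs
      · rw [monomial_mul]
      · rw [mul_zero]

end Frobenius

theorem iInf_map_le_map_iInf_expand_comp_map {σ K L ι : Type*} [Field K] [Field L] {q : ℕ}
    (hq : 0 < q) (θ : K →+* L) (J : ι → Ideal (MvPolynomial σ K)) :
    ⨅ i, (J i).map ((expand q : MvPolynomial σ L →ₐ[L] _).toRingHom.comp (map θ)) ≤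
      (⨅ i, J i).map ((expand q : MvPolynomial σ L →ₐ[L] _).toRingHom.comp (map θ)) := by
  classical
  refine Ideal.iInf_map_le_map_iInf_of_retractions _ (fun f => ?_) J
  set F := (expand q : MvPolynomial σ L →ₐ[L] _).toRingHom.comp (map θ) with hF
  let _ : Algebra K L := θ.toAlgebra
  let b := Module.Free.chooseBasis K L
  let l : Module.Free.ChooseBasisIndex K L → L →+ K := fun j => (b.coord j).toAddMonoidHom
  have hl : ∀ j a x, l j (θ a * x) = a * l j x := fun j a x => by
    have h := (b.coord j).map_smul a x
    rwa [Algebra.smul_def] at h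
  let C := f.support.image fun d : σ →₀ ℕ => d.mapRange (· % q) (Nat.zero_mod q)
  let S := f.support.biUnion fun d => (b.repr (f.coeff d)).support
  have hsum : f = ∑ c ∈ C, ∑ j ∈ S, monomial c (b j) * F (residuePart q c (l j) f) := by
    have hexp : ∀ c j, F (residuePart q c (l j) f) =
        ∑ d ∈ f.support, if d.mapRange (· % q) (Nat.zero_mod q) = c then
          monomial (q • d.mapRange (· / q) (Nat.zero_div q)) (θ (l j (f.coeff d))) else 0 := by
      intro c j
      conv_lhs => rw [f.as_sum]
      rw [map_sum, map_sum]
      refine Finset.sum_congr rfl fun d _ => ?_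
      rw [residuePart_monomial]
      split_ifs
      · simp [hF, expand_monomial]
      · simp
    simp_rw [hexp, Finset.mul_sum, mul_ite, mul_zero, monomial_mul]
    simp_rw [Finset.sum_comm (s := S)]
    rw [Finset.sum_comm]
    conv_lhs => rw [f.as_sum]
    refine Finset.sum_congr rfl fun d hd => ?_
    have hdC : d.mapRange (· % q) (Nat.zero_mod q) ∈ C := Finset.mem_image_of_mem _ hd
    have hdec : d.mapRange (· % q) (Nat.zero_mod q) +
        q • d.mapRange (· / q) (Nat.zero_div q) = d := by
      ext x
      simp [Nat.mod_add_div]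
    rw [Finset.sum_comm]
    simp_rw [Finset.sum_ite_eq, if_pos hdC, hdec]
    rw [← map_sum]
    congr 1
    have hS : (b.repr (f.coeff d)).support ⊆ S :=
      Finset.subset_biUnion_of_mem (fun d => (b.repr (f.coeff d)).support) hd
    conv_lhs => rw [← b.linearCombination_repr (f.coeff d)]
    rw [Finsupp.linearCombination_apply, Finsupp.sum_of_support_subset _ hS _ (by simp)]
    refine Finset.sum_congr rfl fun j _ => ?_
    rw [Algebra.smul_def, mul_comm]
    rfl
  have hmem : ∀ c j, F (residuePart q c (l j) f) ∈
      Ideal.span {y | ∃ φ : MvPolynomial σ L →+ MvPolynomial σ K,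
        (∀ a b, φ (F a * b) = a * φ b) ∧ y = F (φ f)} := fun c j =>
    Ideal.subset_span ⟨_, residuePart_expand_map_mul hq c θ (l j) (hl j), rfl⟩
  exact Set.mem_of_eq_of_mem hsum <| sum_mem fun c _ => sum_mem fun j _ =>
    Ideal.mul_mem_left _ _ (hmem c j)

/-- Intersections of ideals of a polynomial ring over a field commute with Frobenius powers. -/
theorem iInf_map_iterateFrobenius_le {σ K ι : Type*} [Field K] (p e : ℕ) [Fact p.Prime] [CharP K p]
    (J : ι → Ideal (MvPolynomial σ K)) :
    ⨅ i, (J i).map (iterateFrobenius (MvPolynomial σ K) p e) ≤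
      (⨅ i, J i).map (iterateFrobenius (MvPolynomial σ K) p e) := by
  have hF : iterateFrobenius (MvPolynomial σ K) p e =
      (expand (p ^ e) : MvPolynomial σ K →ₐ[K] _).toRingHom.comp
        (map (iterateFrobenius K p e)) := by
    refine RingHom.ext fun f => ?_
    rw [iterateFrobenius_def, ← map_iterateFrobenius_expand, map_expand]
    rfl
  rw [hF]
  exact iInf_map_le_map_iInf_expand_comp_map (pow_pos (Fact.out (p := p.Prime)).pos e) _ J

/-- A finite set of minimal exponents of a monomial ideal is no larger than any generating set. -/
theorem card_le_card_of_minimal {σ K : Type*} [Field K] {S : Set (σ →₀ ℕ)}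
    {T : Finset (MvPolynomial σ K)}
    (hT : Ideal.span ((fun d => monomial d (1 : K)) '' S) = Ideal.span (T : Set (MvPolynomial σ K)))
    (M : Finset (σ →₀ ℕ)) (hM : ∀ d ∈ M, Minimal (· ∈ S) d) : M.card ≤ T.card := by
  classical
  let Λ : MvPolynomial σ K →ₗ[K] (M → K) := LinearMap.pi fun d => lcoeff K d.1
  have hmul : ∀ h, ∀ f ∈ Ideal.span (T : Set (MvPolynomial σ K)),
      Λ (h * f) = coeff 0 h • Λ f := by
    intro h f hf
    rw [← hT, mem_ideal_span_monomial_image] at hf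
    ext ⟨d, hd⟩
    change coeff d (h * f) = coeff 0 h * coeff d f
    rw [coeff_mul, Finset.sum_eq_single (0, d)]
    · rintro ⟨u, v⟩ huv hne
      rw [Finset.HasAntidiagonal.mem_antidiagonal] at huv
      dsimp only at huv ⊢
      by_contra h0
      obtain ⟨w, hwS, hwv⟩ := hf v (mem_support_iff.2 (right_ne_zero_of_mul h0))
      have hvd : v ≤ d := huv ▸ le_add_self
      have : v = d := le_antisymm hvd (((hM d hd).2 hwS (hwv.trans hvd)).trans hwv)
      subst this
      exact hne (by simpa using huv)
    · simp
  have hspan : ∀ f ∈ Ideal.span (T : Set (MvPolynomial σ K)),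
      Λ f ∈ Submodule.span K ((T.image Λ : Finset (M → K)) : Set (M → K)) := by
    intro f hf
    induction hf using Submodule.span_induction with
    | mem x hx => exact Submodule.subset_span (by simpa using ⟨x, hx, rfl⟩)
    | zero => simp
    | add x y _ _ hx hy => rw [map_add]; exact add_mem hx hy
    | smul a x hx ih =>
      rw [smul_eq_mul, hmul a x hx]
      exact Submodule.smul_mem _ _ ih
  have htop : Submodule.span K ((T.image Λ : Finset (M → K)) : Set (M → K)) = ⊤ := by
    rw [eq_top_iff, ← (Pi.basisFun K M).span_eq, Submodule.span_le]
    rintro _ ⟨d, rfl⟩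
    have hd := hspan (monomial d.1 1) (hT ▸ Ideal.subset_span ⟨d.1, (hM d.1 d.2).1, rfl⟩)
    refine Set.mem_of_eq_of_mem ?_ hd
    ext d'
    change _ = coeff d'.1 (monomial d.1 1)
    rw [Pi.basisFun_apply, Pi.single_apply, coeff_monomial]
    simp only [Subtype.ext_iff, eq_comm (a := d'.1)]
  calc M.card = Module.finrank K (M → K) := by simp
    _ = Set.finrank K ((T.image Λ : Finset (M → K)) : Set (M → K)) := by
      rw [Set.finrank, htop, finrank_top]
    _ ≤ (T.image Λ).card := finrank_span_finset_le_card _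
    _ ≤ T.card := Finset.card_image_le

/-- A monomial ideal generated by at most `g` elements is generated by at most `g` monomials. -/
theorem _root_.IsMonomialIdeal.exists_finset_card_le {σ K : Type*} [Field K]
    {J : Ideal (MvPolynomial σ K)} (hJ : IsMonomialIdeal J) {T : Finset (MvPolynomial σ K)}
    (hT : J = Ideal.span (T : Set (MvPolynomial σ K))) :
    ∃ M : Finset (σ →₀ ℕ), M.card ≤ T.card ∧
      J = Ideal.span ((fun d => monomial d (1 : K)) '' (M : Set (σ →₀ ℕ))) := by
  obtain ⟨S, rfl⟩ := hJ
  have hfin : {d | Minimal (· ∈ S) d}.Finite := by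
    by_contra hinf
    obtain ⟨M, hM, hcard⟩ := Set.Infinite.exists_subset_card_eq hinf (T.card + 1)
    have := card_le_card_of_minimal hT M fun d hd => hM hd
    omega
  refine ⟨hfin.toFinset, card_le_card_of_minimal hT _ fun d hd => hfin.mem_toFinset.1 hd, ?_⟩
  ext f
  simp only [mem_ideal_span_monomial_image, Set.Finite.coe_toFinset]
  refine forall₂_congr fun d _ => ⟨?_, ?_⟩
  · rintro ⟨s, hs, hsd⟩
    obtain ⟨t, hts, ht⟩ := exists_minimal_le_of_wellFoundedLT (· ∈ S) s hs
    exact ⟨t, ht, hts.trans hsd⟩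
  · rintro ⟨s, hs, hsd⟩
    exact ⟨s, hs.1, hsd⟩

theorem iInf_span_monomial_smul_le {σ K ι : Type*} [CommSemiring K] {r : ℕ} (hr : 0 < r)
    (S : ι → Set (σ →₀ ℕ)) :
    ⨅ i, Ideal.span ((fun d => monomial (r • d) (1 : K)) '' S i) ≤
      (⨅ i, Ideal.span ((fun d => monomial d (1 : K)) '' S i)) ^ r := by
  intro f hf
  rw [f.as_sum]
  refine sum_mem fun d hd => ?_
  set v : σ →₀ ℕ := d.mapRange (· / r) (Nat.zero_div r)
  have hvd : r • v ≤ d := fun x => by simpa [v] using Nat.mul_div_le (d x) r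
  have hv : monomial v (1 : K) ∈ ⨅ i, Ideal.span ((fun d => monomial d (1 : K)) '' S i) := by
    refine Ideal.mem_iInf.2 fun i => ?_
    have hfi := Ideal.mem_iInf.1 hf i
    rw [← Set.image_image (fun d => monomial d (1 : K)) (fun d => r • d),
      mem_ideal_span_monomial_image] at hfi
    obtain ⟨_, ⟨s, hs, rfl⟩, hsd⟩ := hfi d hd
    have hsv : s ≤ v := fun x => by
      simpa [v, Nat.le_div_iff_mul_le hr, mul_comm] using hsd x
    rw [mem_ideal_span_monomial_image]
    intro w hw
    have hwv : w = v := by simpa using support_monomial_subset hw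
    exact ⟨s, hs, hwv ▸ hsv⟩
  have hmon : monomial d (f.coeff d) = monomial (d - r • v) (f.coeff d) *
      monomial v (1 : K) ^ r := by
    rw [monomial_pow, one_pow, monomial_mul, mul_one, tsub_add_cancel_of_le hvd]
  rw [hmon]
  exact Ideal.mul_mem_left _ _ (Ideal.pow_mem_pow hv r)

end MvPolynomial

/-- if `J_1,…,J_s` are ideals of a polynomial ring, each generated by at
most `g` elements, and either all are monomial ideals or `char K = p > 0` with `r` a
power of `p`, then `⋂ᵢ Jᵢ^m ⊆ (⋂ᵢ Jᵢ)^r` whenever `m ≥ gr - g + 1`. -/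
theorem stmt14 {K : Type*} [Field K] {σ : Type*} (g r s : ℕ) (hg : 0 < g) (hr : 0 < r)
    (J : Fin s → Ideal (MvPolynomial σ K))
    (hgen : ∀ i, ∃ T : Finset (MvPolynomial σ K), T.card ≤ g ∧ J i = Ideal.span ↑T)
    (hcase : (∀ i, IsMonomialIdeal (J i)) ∨
      (∃ p : ℕ, p.Prime ∧ CharP K p ∧ ∃ e : ℕ, r = p ^ e)) :
    ∀ m : ℕ, g * r - g + 1 ≤ m → (⨅ i, (J i) ^ m) ≤ (⨅ i, J i) ^ r := by
  classical
  intro m hm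
  rcases hcase with hmon | ⟨p, hp, hchar, e, rfl⟩
  · choose T hTcard hT using hgen
    choose M hMcard hM using fun i => (hmon i).exists_finset_card_le (hT i)
    have hpow : ∀ i, J i ^ m ≤
        Ideal.span ((fun d => monomial (r • d) (1 : K)) '' (M i : Set (σ →₀ ℕ))) := by
      intro i
      have hle := Ideal.span_finset_pow_le_span_image_pow hr hm
        ((M i).image fun d => monomial d (1 : K))
        (Finset.card_image_le.trans ((hMcard i).trans (hTcard i)))
      rw [Finset.coe_image, ← hM i, Set.image_image] at hle
      simpa only [monomial_pow, one_pow] using hle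
    calc ⨅ i, J i ^ m
        ≤ ⨅ i, Ideal.span ((fun d => monomial (r • d) (1 : K)) '' (M i : Set (σ →₀ ℕ))) :=
          iInf_mono hpow
      _ ≤ (⨅ i, Ideal.span ((fun d => monomial d (1 : K)) '' (M i : Set (σ →₀ ℕ)))) ^ r :=
          iInf_span_monomial_smul_le hr _
      _ = (⨅ i, J i) ^ r := by simp_rw [← hM]
  · have : Fact p.Prime := ⟨hp⟩
    have hpow : ∀ i, J i ^ m ≤ (J i).map (iterateFrobenius (MvPolynomial σ K) p e) := by
      intro i
      obtain ⟨T, hTcard, hT⟩ := hgen i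
      rw [hT, Ideal.map_span]
      exact Ideal.span_finset_pow_le_span_image_pow hr hm T hTcard
    refine (iInf_mono hpow).trans ((iInf_map_iterateFrobenius_le p e J).trans ?_)
    refine Ideal.map_le_iff_le_comap.2 fun x hx => ?_
    exact Ideal.pow_mem_pow hx (p ^ e)

end
end

section
/- Let I ⊆ K[x_0,...,x_N] be a monomial ideal over a field K. Then I^(rN-(N-1)) ⊆ I^r holds for all r ≥ 1. -/
open MvPolynomial
open scoped LinearAlgebra.Projectivization

noncomputable section

/-- The `m`-th symbolic power of an ideal `I`:
`I⁽ᵐ⁾ = R ∩ (⋂_{P ∈ Ass(R/I)} (Iᵐ)_P)`, described elementwise. -/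
def symbolicPower {R : Type*} [CommRing R] (I : Ideal R) (m : ℕ) : Ideal R where
  carrier := {x | ∀ P ∈ associatedPrimes R (R ⧸ I), ∃ s ∉ P, s * x ∈ I ^ m}
  zero_mem' := by
    intro P hP
    refine ⟨1, fun h => hP.isPrime.ne_top (Ideal.eq_top_of_isUnit_mem _ h isUnit_one), ?_⟩
    simp
  add_mem' := by
    intro x y hx hy P hP
    obtain ⟨s, hs, hsx⟩ := hx P hP
    obtain ⟨t, ht, hty⟩ := hy P hP
    refine ⟨s * t, fun h => ?_, ?_⟩
    · rcases hP.isPrime.mem_or_mem h with h' | h'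
      exacts [hs h', ht h']
    · have heq : s * t * (x + y) = t * (s * x) + s * (t * y) := by ring
      rw [heq]
      exact add_mem (Ideal.mul_mem_left _ _ hsx) (Ideal.mul_mem_left _ _ hty)
  smul_mem' := by
    intro c x hx P hP
    obtain ⟨s, hs, hsx⟩ := hx P hP
    refine ⟨s, hs, ?_⟩
    have heq : s * (c • x) = c * (s * x) := by
      simp only [smul_eq_mul]; ring
    rw [heq]
    exact Ideal.mul_mem_left _ _ hsx

theorem MvPolynomial.mem_of_forall_monomial_mem {σ K : Type*} [CommSemiring K]
    {J : Ideal (MvPolynomial σ K)} {f : MvPolynomial σ K}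
    (h : ∀ c ∈ f.support, monomial c (1 : K) ∈ J) : f ∈ J := by
  rw [f.as_sum]
  refine sum_mem fun c hc => ?_
  rw [show monomial c (f.coeff c) = C (f.coeff c) * monomial c 1 by simp [C_mul_monomial]]
  exact J.mul_mem_left _ (h c hc)

theorem MvPolynomial.monomial_mem_of_le {σ K : Type*} [CommSemiring K]
    {J : Ideal (MvPolynomial σ K)} {c d : σ →₀ ℕ} (hcd : c ≤ d)
    (hc : monomial c (1 : K) ∈ J) : monomial d (1 : K) ∈ J :=
  J.mem_of_dvd (monomial_dvd_monomial.2 ⟨Or.inr hcd, dvd_rfl⟩) hc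

namespace IsMonomialIdeal

variable {σ K : Type*} [CommSemiring K] {I J : Ideal (MvPolynomial σ K)}

theorem monomial_mem (hJ : IsMonomialIdeal J) {f : MvPolynomial σ K} (hf : f ∈ J)
    {c : σ →₀ ℕ} (hc : c ∈ f.support) : monomial c (1 : K) ∈ J := by
  obtain ⟨S, rfl⟩ := hJ
  obtain ⟨d, hd, hdc⟩ := mem_ideal_span_monomial_image.1 hf c hc
  exact monomial_mem_of_le hdc (Ideal.subset_span ⟨d, hd, rfl⟩)

theorem mul (hI : IsMonomialIdeal I) (hJ : IsMonomialIdeal J) : IsMonomialIdeal (I * J) := by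
  obtain ⟨S, rfl⟩ := hI
  obtain ⟨T, rfl⟩ := hJ
  refine ⟨Set.image2 (· + ·) S T, ?_⟩
  rw [Ideal.span_mul_span', ← Set.image2_mul, Set.image2_image_left, Set.image2_image_right,
    Set.image_image2]
  simp

theorem pow (hI : IsMonomialIdeal I) (n : ℕ) : IsMonomialIdeal (I ^ n) := by
  induction n with
  | zero => exact ⟨{0}, by simp⟩
  | succ n ih => exact pow_succ I n ▸ ih.mul hI

theorem le_of_mem_support_of_mem_pow (hI : IsMonomialIdeal I) {w : (σ →₀ ℕ) → ℕ}
    (hw : ∀ a b, w a + w b ≤ w (a + b)) (hw1 : ∀ c, monomial c (1 : K) ∈ I → 1 ≤ w c) (n : ℕ) :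
    ∀ f ∈ I ^ n, ∀ c ∈ f.support, n ≤ w c := by
  classical
  induction n with
  | zero => simp
  | succ n ih =>
    intro f hf
    rw [pow_succ] at hf
    induction hf using Submodule.mul_induction_on' with
    | mem_mul_mem p hp q hq =>
      intro c hc
      obtain ⟨a, ha, b, hb, rfl⟩ := Finset.mem_add.1 (support_mul p q hc)
      exact (add_le_add (ih p hp a ha) (hw1 b (hI.monomial_mem hq hb))).trans (hw a b)
    | add p _ q _ hp hq =>
      intro c hc
      exact (Finset.mem_union.1 (support_add hc)).elim (hp c) (hq c)

end IsMonomialIdeal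

/-- If `S` is an upper set of exponents that does not see variables outside `A`, and `s` has a term
in which no variable of `A` occurs, then `f` is supported in `S` as soon as `s * f` is. -/
theorem MvPolynomial.support_subset_of_mul {σ K : Type*} [CommRing K] [NoZeroDivisors K]
    (A : Finset σ) {S : Set (σ →₀ ℕ)} (hS : IsUpperSet S)
    (hA : ∀ t c : σ →₀ ℕ, (∀ i ∈ A, t i = 0) → t + c ∈ S → c ∈ S) {s f : MvPolynomial σ K}
    (hs : ∃ t ∈ s.support, ∀ i ∈ A, t i = 0) (h : ∀ c ∈ (s * f).support, c ∈ S) :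
    ∀ c ∈ f.support, c ∈ S := by
  classical
  by_contra! hf
  obtain ⟨c₀, hc₀, hc₀S⟩ := hf
  let deg : (σ →₀ ℕ) → ℕ := fun c => ∑ i ∈ A, c i
  have deg_add (a b) : deg (a + b) = deg a + deg b := by simp [deg, Finset.sum_add_distrib]
  let F := f.support.filter (· ∉ S)
  obtain ⟨c₁, hc₁, hmin⟩ := F.exists_min_image deg ⟨c₀, by simp_all [F]⟩
  let T := s.support.filter fun t => ∀ i ∈ A, t i = 0
  obtain ⟨t₀, ht₀, ht₀A⟩ := hs
  obtain ⟨t, ht, c, hc, hu⟩ := UniqueSums.uniqueAdd_of_nonempty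
    (A := T) (B := F.filter (deg · = deg c₁)) ⟨t₀, Finset.mem_filter.2 ⟨ht₀, ht₀A⟩⟩
    ⟨c₁, by simp [hc₁]⟩
  simp only [F, T, Finset.mem_filter] at ht hc hmin
  have hdt : deg t = 0 := Finset.sum_eq_zero ht.2
  have htc : t + c ∉ S := fun h' => hc.1.2 (hA t c ht.2 h')
  refine htc (h _ (mem_support_iff.2 ?_))
  rw [coeff_mul, Finset.sum_eq_single (t, c)]
  · exact mul_ne_zero (mem_support_iff.1 ht.1) (mem_support_iff.1 hc.1.1)
  · rintro ⟨a, b⟩ hab hne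
    rw [Finset.HasAntidiagonal.mem_antidiagonal] at hab
    by_contra h0
    have ha : a ∈ s.support := mem_support_iff.2 (left_ne_zero_of_mul h0)
    have hb : b ∈ f.support := mem_support_iff.2 (right_ne_zero_of_mul h0)
    have hbS : b ∉ S := fun h' => htc (hS (hab ▸ le_add_self) h')
    have h1 := hmin b ⟨hb, hbS⟩
    have h2 : deg a + deg b = deg t + deg c := by rw [← deg_add, ← deg_add, hab]
    have ha0 : deg a = 0 := by omega
    obtain ⟨rfl, rfl⟩ := hu (a := a) (b := b)
      (by simpa [T] using ⟨mem_support_iff.1 ha, Finset.sum_eq_zero_iff.1 ha0⟩)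
      (by simp only [F, Finset.mem_filter]; exact ⟨⟨hb, hbS⟩, by omega⟩) hab
    exact hne rfl
  · simp

theorem MvPolynomial.isPrime_span_X_image_finset {σ K : Type*} [CommRing K] [IsDomain K]
    (A : Finset σ) : (Ideal.span (X '' (A : Set σ) : Set (MvPolynomial σ K))).IsPrime := by
  refine ⟨fun h => ?_, fun {s f} h => or_iff_not_imp_left.2 fun hs => ?_⟩
  · have := mem_ideal_span_X_image.1 (h ▸ Submodule.mem_top : (1 : MvPolynomial σ K) ∈ _) 0
    simp at this
  · rw [mem_ideal_span_X_image] at *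
    push Not at hs
    refine support_subset_of_mul A (S := {c | ∃ i ∈ (A : Set σ), c i ≠ 0}) ?_ ?_ hs h
    · rintro a b hab ⟨i, hi, h0⟩
      exact ⟨i, hi, (pos_of_ne_zero h0 |>.trans_le (hab i)).ne'⟩
    · rintro t c ht ⟨i, hi, h0⟩
      exact ⟨i, hi, by simpa [ht i hi] using h0⟩

/-- A monomial outside a monomial ideal `I` divides a monomial `x ^ e` for which `I : x ^ e` is
generated by variables. -/
theorem IsMonomialIdeal.exists_colon_eq_span_X {σ K : Type*} [Finite σ] [CommRing K]
    [IsNoetherianRing K] {I : Ideal (MvPolynomial σ K)} (hI : IsMonomialIdeal I) {d : σ →₀ ℕ}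
    (hd : monomial d (1 : K) ∉ I) :
    ∃ e, d ≤ e ∧ ∃ A : Finset σ, I.colon {monomial e (1 : K)} = Ideal.span (X '' (A : Set σ)) := by
  classical
  have := Fintype.ofFinite σ
  obtain ⟨_, ⟨e, ⟨hde, he⟩, rfl⟩, hmax⟩ := set_has_maximal_iff_noetherian.2
    (inferInstanceAs (IsNoetherian (MvPolynomial σ K) (MvPolynomial σ K)))
    ((fun e => I.colon {monomial e (1 : K)}) '' {e | d ≤ e ∧ monomial e (1 : K) ∉ I})
    ⟨_, d, ⟨le_rfl, hd⟩, rfl⟩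
  refine ⟨e, hde, Finset.univ.filter fun i => monomial (e + Finsupp.single i 1) (1 : K) ∈ I, ?_⟩
  have key (b : σ →₀ ℕ) (hb : monomial (e + b) (1 : K) ∈ I) :
      ∃ i, monomial (e + Finsupp.single i 1) (1 : K) ∈ I ∧ b i ≠ 0 := by
    induction b using WellFoundedLT.induction with
    | ind b ih =>
      obtain rfl | hb0 := eq_or_ne b 0
      · exact absurd (by simpa using hb) he
      obtain ⟨i, hi⟩ := Finsupp.ne_iff.1 hb0
      by_cases hei : monomial (e + Finsupp.single i 1) (1 : K) ∈ I
      · exact ⟨i, hei, hi⟩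
      have hle : Finsupp.single i 1 ≤ b := Finsupp.single_le_iff.2 (Nat.one_le_iff_ne_zero.2 hi)
      have hcolon : I.colon {monomial e (1 : K)} ≤
          I.colon {monomial (e + Finsupp.single i 1) (1 : K)} := fun f hf => by
        rw [Submodule.mem_colon_singleton] at hf ⊢
        have := I.mul_mem_right (X i) hf
        rwa [smul_eq_mul, mul_assoc, X, monomial_mul, one_mul] at this
      have heq := hcolon.eq_of_not_lt (hmax _ ⟨_, ⟨hde.trans le_self_add, hei⟩, rfl⟩)
      have hmem : monomial (b - Finsupp.single i 1) (1 : K) ∈ I.colon {monomial e (1 : K)} := by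
        rw [heq, Submodule.mem_colon_singleton, smul_eq_mul, monomial_mul, one_mul, add_left_comm,
          tsub_add_cancel_of_le hle]
        exact hb
      rw [Submodule.mem_colon_singleton, smul_eq_mul, monomial_mul, one_mul, add_comm] at hmem
      have hlt : b - Finsupp.single i 1 < b := by
        refine lt_of_le_of_ne tsub_le_self fun h => ?_
        have := DFunLike.congr_fun h i
        simp at this hi
        omega
      obtain ⟨j, hj, hbj⟩ := ih _ hlt hmem
      exact ⟨j, hj, fun h => hbj (by simp [h])⟩
  ext f
  rw [Submodule.mem_colon_singleton, smul_eq_mul, mem_ideal_span_X_image]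
  constructor
  · intro hf c hc
    have := hI.monomial_mem hf (c := e + c) (by
      simpa [mem_support_iff, coeff_mul_monomial', add_comm e c] using hc)
    simpa using key c this
  · intro hf
    refine mem_of_forall_monomial_mem fun c hc => ?_
    have hc' := hc
    rw [mem_support_iff, coeff_mul_monomial'] at hc'
    obtain ⟨hec, h0⟩ := ite_ne_right_iff.1 hc'
    obtain ⟨i, hi, hci⟩ := hf (c - e) (mem_support_iff.2 (by simpa using h0))
    refine monomial_mem_of_le ?_ (by simpa using hi)
    rw [← add_tsub_cancel_of_le hec]
    gcongr
    exact Finsupp.single_le_iff.2 (Nat.one_le_iff_ne_zero.2 hci)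

theorem Ideal.mem_associatedPrimes_quotient_of_eq_colon {R : Type*} [CommRing R] {I P : Ideal R}
    [hP : P.IsPrime] {x : R} (h : I.colon {x} = P) : P ∈ associatedPrimes R (R ⧸ I) := by
  refine ⟨hP, Ideal.Quotient.mk I x, ?_⟩
  rw [← hP.radical]
  congr 1
  ext y
  rw [← h, Submodule.mem_colon_singleton, Submodule.mem_colon_singleton, Submodule.mem_bot,
    ← Ideal.Quotient.eq_zero_iff_mem]
  rfl

/-- for a monomial ideal `I ⊆ K[x_0,…,x_N]`,
`I^(rN-(N-1)) ⊆ I^r` for all `r ≥ 1`. -/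
theorem stmt15 {K : Type*} [Field K] {N : ℕ} (hN : 1 ≤ N)
    (I : Ideal (MvPolynomial (Fin (N + 1)) K)) (hmono : IsMonomialIdeal I) :
    ∀ r : ℕ, 1 ≤ r → symbolicPower I (r * N - (N - 1)) ≤ I ^ r := by
  classical
  intro r hr f hf
  set m := r * N - (N - 1) with hm
  have hmr : r ≤ m := by
    obtain ⟨n, rfl⟩ := Nat.exists_eq_add_of_le' hN
    obtain ⟨q, rfl⟩ := Nat.exists_eq_add_of_le' hr
    rw [hm, Nat.le_sub_iff_add_le] <;> simp <;> nlinarith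
  refine mem_of_forall_monomial_mem fun c hc => ?_
  let d : Fin (N + 1) →₀ ℕ := Finsupp.equivFunOnFinite.symm fun i => c i / r
  have hd (i) : d i = c i / r := rfl
  by_cases hdI : monomial d (1 : K) ∈ I
  · have := Ideal.pow_mem_pow hdI r
    rw [monomial_pow, one_pow] at this
    refine monomial_mem_of_le (fun i => ?_) this
    simpa [hd] using Nat.mul_div_le (c i) r
  obtain ⟨e, hde, A, hA⟩ := hmono.exists_colon_eq_span_X hdI
  have hprime := isPrime_span_X_image_finset (K := K) A
  obtain ⟨s, hs, hsf⟩ := hf _ (Ideal.mem_associatedPrimes_quotient_of_eq_colon hA)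
  rw [mem_ideal_span_X_image] at hs
  push Not at hs
  obtain rfl | hAu := eq_or_ne A Finset.univ
  · refine Ideal.pow_le_pow_right hmr ?_
    refine support_subset_of_mul (s := s) Finset.univ (S := {c | monomial c (1 : K) ∈ I ^ m})
      (fun a b hab ha => monomial_mem_of_le hab ha) (fun t c ht h => ?_) hs
      (fun c hc => (hmono.pow m).monomial_mem hsf hc) c hc
    obtain rfl : t = 0 := Finsupp.ext fun i => ht i (Finset.mem_univ i)
    simpa using h
  let w : (Fin (N + 1) →₀ ℕ) → ℕ := fun c => ∑ i ∈ A, c i / (e i + 1)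
  have hw1 (c : Fin (N + 1) →₀ ℕ) (hcI : monomial c (1 : K) ∈ I) : 1 ≤ w c := by
    have hce : monomial (c - e) (1 : K) ∈ I.colon {monomial e (1 : K)} := by
      rw [Submodule.mem_colon_singleton, smul_eq_mul, monomial_mul, one_mul]
      exact monomial_mem_of_le le_tsub_add hcI
    rw [hA, mem_ideal_span_X_image] at hce
    obtain ⟨i, hi, hci⟩ := hce (c - e) (by simp)
    refine le_trans ?_ (Finset.single_le_sum (fun _ _ => Nat.zero_le _) (Finset.mem_coe.1 hi))
    rw [Nat.one_le_div_iff (Nat.succ_pos _)]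
    rw [Finsupp.tsub_apply] at hci
    omega
  have hcw : m ≤ w c := by
    refine support_subset_of_mul (s := s) A (S := {c | m ≤ w c}) (fun a b hab ha => ?_)
      (fun t c ht h => ?_) hs
      (hmono.le_of_mem_support_of_mem_pow (fun a b => ?_) hw1 m _ hsf) c hc
    · exact le_trans ha (Finset.sum_le_sum fun i _ => Nat.div_le_div_right (hab i))
    · refine le_of_le_of_eq (b := w (t + c)) h (Finset.sum_congr rfl fun i hi => ?_)
      simp [ht i hi]
    · simp only [w, ← Finset.sum_add_distrib]
      exact Finset.sum_le_sum fun i _ => Nat.div_add_div_le_add_div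
  have hcard : A.card ≤ N := by
    simpa [Nat.lt_succ_iff] using Finset.card_lt_card (Finset.ssubset_univ_iff.2 hAu)
  have hlt : ∀ i ∈ A, c i / (e i + 1) ≤ r - 1 := fun i _ => by
    have h1 : c i / r < e i + 1 := Nat.lt_succ_of_le (hde i)
    rw [Nat.div_lt_iff_lt_mul hr] at h1
    have : c i / (e i + 1) < r := by
      rw [Nat.div_lt_iff_lt_mul (Nat.succ_pos _), mul_comm]; exact h1
    omega
  have := Finset.sum_le_card_nsmul A _ _ hlt
  have h2 : A.card * (r - 1) ≤ N * (r - 1) := Nat.mul_le_mul_right _ hcard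
  obtain ⟨n, rfl⟩ := Nat.exists_eq_add_of_le' hN
  obtain ⟨q, rfl⟩ := Nat.exists_eq_add_of_le' hr
  simp only [smul_eq_mul, add_tsub_cancel_right] at this h2 hm
  have h3 : (q + 1) * (n + 1) = (n + 1) * q + n + 1 := by ring
  have h4 : w c ≤ (n + 1) * q := this.trans h2
  omega

end
end

section
/- Let K be a field of characteristic p > 0, let p_1,...,p_n ∈ P^N be distinct K-points, and let I = ∩_i I(p_i) ⊆ K[x_0,...,x_N]. If r is a power of p, then I^(m) ⊆ I^r holds whenever m ≥ rN - N + 1. -/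
open MvPolynomial
open scoped LinearAlgebra.Projectivization

noncomputable section

/-- Extension of ideals along `φ : S →+* R` commutes with intersections as soon as every element
of `R` can be written in `S`-linear coordinates. -/
theorem Ideal.iInf_map_le_map_iInf_of_coord {R S κ ι : Type*} [CommRing R] [CommRing S]
    (φ : S →+* R) (b : κ → R) (c : κ → R →+ S)
    (hc : ∀ k s x, c k (φ s * x) = s * c k x)
    (hb : ∀ x, ∃ t : Finset κ, x = ∑ k ∈ t, φ (c k x) * b k) (J : ι → Ideal S) :
    ⨅ i, (J i).map φ ≤ (⨅ i, J i).map φ := by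
  intro x hx
  have key (k : κ) (i : ι) : c k x ∈ J i := by
    have hxi : x ∈ (J i).map φ := (Submodule.mem_iInf _).1 hx i
    refine Submodule.span_induction (p := fun x _ ↦ ∀ a, c k (a * x) ∈ J i) ?_ ?_ ?_ ?_ hxi 1
      |> (one_mul x ▸ ·)
    · rintro _ ⟨s, hs, rfl⟩ a
      rw [mul_comm, hc]
      exact (J i).mul_mem_right _ hs
    · simp
    · intro x y _ _ h₁ h₂ a
      rw [mul_add, map_add]
      exact (J i).add_mem (h₁ a) (h₂ a)
    · intro r x _ h a
      rw [smul_eq_mul, ← mul_assoc]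
      exact h (a * r)
  obtain ⟨t, ht⟩ := hb x
  rw [ht]
  exact Ideal.sum_mem _ fun k _ ↦ Ideal.mul_mem_right _ _
    (Ideal.mem_map_of_mem φ ((Submodule.mem_iInf _).2 (key k)))

theorem Ideal.iInf_map_algebraMap_le_of_free {R S ι : Type*} [CommRing R] [CommRing S]
    [Algebra S R] [Module.Free S R] (J : ι → Ideal S) :
    ⨅ i, (J i).map (algebraMap S R) ≤ (⨅ i, J i).map (algebraMap S R) := by
  let b := Module.Free.chooseBasis S R
  refine Ideal.iInf_map_le_map_iInf_of_coord (algebraMap S R) b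
    (fun k ↦ (b.coord k).toAddMonoidHom) (fun k s x ↦ ?_) (fun x ↦ ⟨(b.repr x).support, ?_⟩) J
  · simp [← Algebra.smul_def]
  · conv_lhs => rw [← b.linearCombination_repr x]
    simp [Finsupp.linearCombination_apply, Finsupp.sum, Algebra.smul_def]

attribute [local instance] MvPolynomial.algebraMvPolynomial in
theorem MvPolynomial.iInf_map_map_le {σ ι k L : Type*} [Field k] [Field L] (ψ : k →+* L)
    (J : ι → Ideal (MvPolynomial σ k)) :
    ⨅ i, (J i).map (MvPolynomial.map (σ := σ) ψ) ≤
      (⨅ i, J i).map (MvPolynomial.map (σ := σ) ψ) := by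
  let := ψ.toAlgebra
  have h : Algebra.IsPushout k (MvPolynomial σ k) L (MvPolynomial σ L) := inferInstance
  have : Module.Free (MvPolynomial σ k) (MvPolynomial σ L) := h.out.free
  exact Ideal.iInf_map_algebraMap_le_of_free J

theorem MvPolynomial.iInf_map_expand_le {σ ι k : Type*} [CommRing k] {r : ℕ}
    (hr : 0 < r) (J : ι → Ideal (MvPolynomial σ k)) :
    ⨅ i, (J i).map (expand r : MvPolynomial σ k →ₐ[k] MvPolynomial σ k).toRingHom ≤
      (⨅ i, J i).map (expand r : MvPolynomial σ k →ₐ[k] MvPolynomial σ k).toRingHom := by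
  classical
  let rem (m : σ →₀ ℕ) : σ →₀ ℕ := m.mapRange (· % r) (Nat.zero_mod r)
  let quo (m : σ →₀ ℕ) : σ →₀ ℕ := m.mapRange (· / r) (Nat.zero_div r)
  have hrem (d m) : rem (r • d + m) = rem m := by
    ext i; simp [rem]
  have hquo (d m) : quo (r • d + m) = d + quo m := by
    ext i; simp [quo, Nat.mul_add_div hr]
  have hdiv (m) : r • quo m + rem m = m := by
    ext i; simp [rem, quo, Nat.div_add_mod]
  let c (a : σ →₀ ℕ) : MvPolynomial σ k →ₗ[k] MvPolynomial σ k :=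
    (basisMonomials σ k).constr k fun m ↦ if rem m = a then monomial (quo m) 1 else 0
  have hcm (a m t) : c a (monomial m t) = if rem m = a then monomial (quo m) t else 0 := by
    have : monomial m t = t • basisMonomials σ k m := by simp [smul_monomial]
    rw [this, map_smul, Module.Basis.constr_basis]
    split_ifs <;> simp [smul_monomial]
  refine Ideal.iInf_map_le_map_iInf_of_coord _ (fun a ↦ monomial a 1)
    (fun a ↦ (c a).toAddMonoidHom) (fun a s x ↦ ?_) (fun x ↦ ⟨x.support.image rem, ?_⟩) J
  · change c a (expand r s * x) = s * c a x
    induction s using MvPolynomial.induction_on' with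
    | add p q hp hq => rw [map_add, add_mul, map_add, hp, hq, add_mul]
    | monomial d u =>
      induction x using MvPolynomial.induction_on' with
      | add p q hp hq => rw [mul_add, map_add, hp, hq, map_add, mul_add]
      | monomial m t =>
        rw [expand_monomial, monomial_mul, hcm, hcm, hrem, hquo]
        split_ifs <;> simp [monomial_mul]
  · change x = ∑ a ∈ x.support.image rem, expand r (c a x) * monomial a 1
    have hx (a) : c a x = ∑ m ∈ x.support,
        if rem m = a then monomial (quo m) (coeff m x) else 0 := by
      conv_lhs => rw [x.as_sum, map_sum]
      simp only [hcm]
    simp only [hx, map_sum, Finset.sum_mul]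
    rw [Finset.sum_comm]
    conv_lhs => rw [x.as_sum]
    refine Finset.sum_congr rfl fun m hm ↦ ?_
    rw [Finset.sum_eq_single_of_mem (rem m) (Finset.mem_image_of_mem _ hm)]
    · simp [monomial_mul, hdiv]
    · intro a _ ha
      simp [ha.symm]

/-- Over a field, Frobenius powers of ideals of a polynomial ring commute with intersections. -/
theorem MvPolynomial.iInf_map_iterateFrobenius_le_s16 {σ ι K : Type*} [Field K] (q e : ℕ)
    [ExpChar K q] (J : ι → Ideal (MvPolynomial σ K)) :
    ⨅ i, (J i).map (iterateFrobenius (MvPolynomial σ K) q e) ≤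
      (⨅ i, J i).map (iterateFrobenius (MvPolynomial σ K) q e) := by
  have h : iterateFrobenius (MvPolynomial σ K) q e =
      (MvPolynomial.map (iterateFrobenius K q e)).comp
        (expand (q ^ e) : MvPolynomial σ K →ₐ[K] MvPolynomial σ K).toRingHom :=
    RingHom.ext fun f ↦ (map_iterateFrobenius_expand q f e).symm
  simp only [h, ← Ideal.map_map]
  exact (MvPolynomial.iInf_map_map_le _ _).trans
    (Ideal.map_mono (MvPolynomial.iInf_map_expand_le (expChar_pow_pos K q e) J))

theorem Ideal.sup_pow_add_succ_le {R : Type*} [CommRing R] (I J : Ideal R) (a b : ℕ) :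
    (I ⊔ J) ^ (a + b + 1) ≤ I ^ (a + 1) ⊔ J ^ (b + 1) := by
  rw [← Ideal.add_eq_sup, ← Ideal.add_eq_sup, add_pow, Ideal.sum_eq_sup]
  refine Finset.sup_le fun i _ ↦ Ideal.mul_le_left.trans ?_
  by_cases hi : a + 1 ≤ i
  · exact Ideal.mul_le_left.trans ((Ideal.pow_le_pow_right hi).trans le_sup_left)
  · exact Ideal.mul_le_right.trans ((Ideal.pow_le_pow_right (by lia)).trans le_sup_right)

theorem Ideal.span_image_pow_le_span_image_pow {R α : Type*} [CommRing R] (x : α → R)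
    (s : Finset α) (a : ℕ) :
    Ideal.span (x '' s) ^ (a * s.card + 1) ≤ Ideal.span ((fun i ↦ x i ^ (a + 1)) '' s) := by
  classical
  induction s using Finset.induction_on with
  | empty => simp
  | insert i s hi ih =>
    rw [Finset.card_insert_of_notMem hi, Finset.coe_insert, Set.image_insert_eq,
      Set.image_insert_eq, Ideal.span_insert, Ideal.span_insert, mul_add, mul_one,
      add_comm (a * s.card) a]
    refine (Ideal.sup_pow_add_succ_le _ _ _ _).trans (sup_le_sup ?_ ih)
    rw [Ideal.span_singleton_pow]

theorem MvPolynomial.IsHomogeneous.aeval_smul_const {σ K A : Type*} [Fintype σ] [CommRing K]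
    [CommRing A] [Algebra K A] {f : MvPolynomial σ K} {d : ℕ} (hf : f.IsHomogeneous d)
    (v : σ → K) (t : A) :
    MvPolynomial.aeval (fun j ↦ v j • t) f = eval v f • t ^ d := by
  rw [MvPolynomial.aeval_def, eval₂_eq', eval_eq', Finset.sum_smul]
  refine Finset.sum_congr rfl fun m hm ↦ ?_
  have hd : ∑ i, m i = d := by
    rw [← Finsupp.degree_eq_sum]
    by_contra h
    exact mem_support_iff.1 hm (hf.coeff_eq_zero h)
  simp only [smul_pow, Finset.prod_smul, Finset.prod_pow_eq_pow_sum, hd, ← Algebra.smul_def,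
    smul_smul]

theorem exists_pointIdeal_eq_span {K : Type*} [Field K] {N : ℕ} (P : ℙ K (Fin (N + 1) → K)) :
    ∃ (s : Finset (Fin (N + 1))) (x : Fin (N + 1) → MvPolynomial (Fin (N + 1)) K),
      s.card = N ∧ pointIdeal P = Ideal.span (x '' s) := by
  obtain ⟨k, hk⟩ : ∃ k, P.rep k ≠ 0 := Function.ne_iff.1 P.rep_nonzero
  set v := P.rep with hv
  let T : MvPolynomial (Fin (N + 1)) K := C (v k)⁻¹ * X k
  refine ⟨{k}ᶜ, fun j ↦ X j - C (v j) * T, by simp [Finset.card_compl], le_antisymm ?_ ?_⟩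
  · refine Ideal.span_le.2 ?_
    rintro f ⟨⟨d, hd⟩, h0⟩
    set I := Ideal.span ((fun j ↦ X j - C (v j) * T) '' (({k}ᶜ : Finset (Fin (N + 1))) :
      Set (Fin (N + 1))))
    have hX (j) : Ideal.Quotient.mkₐ K I (X j) = v j • Ideal.Quotient.mkₐ K I T := by
      rw [← map_smul, smul_eq_C_mul]
      by_cases hj : j = k
      · subst hj
        congr 1
        simp [T, ← mul_assoc, ← C_mul, hk]
      · exact Ideal.Quotient.eq.2 (Ideal.subset_span ⟨j, by simpa using hj, rfl⟩)
    have h : Ideal.Quotient.mkₐ K I = aeval fun j ↦ v j • Ideal.Quotient.mkₐ K I T :=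
      algHom_ext fun j ↦ by rw [hX, aeval_X]
    have hf : Ideal.Quotient.mkₐ K I f = 0 := by
      rw [h, hd.aeval_smul_const, h0, zero_smul]
    exact Ideal.Quotient.eq_zero_iff_mem.1 hf
  · refine Ideal.span_le.2 ?_
    rintro _ ⟨j, -, rfl⟩
    refine Ideal.subset_span ⟨⟨1, (isHomogeneous_X _ _).sub ?_⟩, ?_⟩
    · simpa only [T, zero_add] using
        (isHomogeneous_C _ (v j)).mul ((isHomogeneous_C _ (v k)⁻¹).mul (isHomogeneous_X K k))
    · simp [T, ← hv, hk]

/-- in characteristic `p > 0`, for the radical ideal `I` of distinct points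
of `ℙ^N` and `r` a power of `p`, `I^(m) ⊆ I^r` whenever `m ≥ rN - N + 1`. -/
theorem stmt16 {K : Type*} [Field K] (q : ℕ) (hq : q.Prime) [CharP K q]
    {N n : ℕ} (hn : 0 < n)
    (p : Fin n → ℙ K (Fin (N + 1) → K)) (hinj : Function.Injective p)
    (r : ℕ) (hrpow : ∃ e : ℕ, r = q ^ e) :
    ∀ m : ℕ, r * N - N + 1 ≤ m →
      (⨅ i, (pointIdeal (p i)) ^ m) ≤ (⨅ i, pointIdeal (p i)) ^ r := by
  intro m hm
  obtain ⟨e, rfl⟩ := hrpow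
  have : ExpChar K q := .prime hq
  have hpos : 0 < q ^ e := pow_pos hq.pos e
  have hpoint (P : ℙ K (Fin (N + 1) → K)) : pointIdeal P ^ m ≤
      (pointIdeal P).map (iterateFrobenius (MvPolynomial (Fin (N + 1)) K) q e) := by
    obtain ⟨s, x, hs, hP⟩ := exists_pointIdeal_eq_span P
    have hm' : (q ^ e - 1) * s.card + 1 ≤ m := by rwa [hs, Nat.sub_mul, one_mul]
    rw [hP, Ideal.map_span, ← Set.image_comp]
    refine (Ideal.pow_le_pow_right hm').trans
      ((Ideal.span_image_pow_le_span_image_pow x s _).trans_eq ?_)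
    rw [Nat.sub_add_cancel hpos]
    rfl
  refine (iInf_mono fun i ↦ hpoint (p i)).trans
    ((MvPolynomial.iInf_map_iterateFrobenius_le_s16 q e _).trans (Ideal.map_le_iff_le_comap.2 ?_))
  exact fun f hf ↦ Ideal.pow_mem_pow hf _

end
end

section
/- Let I ⊆ K[x_0,...,x_N] be the radical ideal of a finite set of distinct points p_1,...,p_n ∈ P^N. If either α(I) = 1, or the points form a star configuration, or γ(I) > (α(I)+N-1)/N, then α(I^(Nr-N+1)) ≥ r·α(I) + (r-1)(N-1) holds for all sufficiently large r. -/
open MvPolynomial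
open scoped LinearAlgebra.Projectivization

noncomputable section

/-- `α(J)`: the least degree of a nonzero form in `J`. -/
def alphaDeg {σ K : Type*} [CommSemiring K] (J : Ideal (MvPolynomial σ K)) : ℕ :=
  sInf {d : ℕ | ∃ f ∈ J, f ≠ 0 ∧ MvPolynomial.IsHomogeneous f d}

/-- A family of `n = C(s,N)` distinct points of `ℙ^N` is a star configuration for `s ≥ N`
hyperplanes (in general position: no `N+1` of them meet in a single point) if the points
are exactly the points obtained by intersecting `N` of the `s` hyperplanes. The
hyperplanes are recorded by linear functionals `φ` in general position (any
`min(s, N+1)` of them are linearly independent). -/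
def IsStarConfiguration {K : Type*} [Field K] {N n : ℕ} (s : ℕ)
    (p : Fin n → ℙ K (Fin (N + 1) → K)) : Prop :=
  N ≤ s ∧ n = Nat.choose s N ∧ Function.Injective p ∧
  ∃ φ : Fin s → ((Fin (N + 1) → K) →ₗ[K] K),
    (∀ T : Finset (Fin s), T.card ≤ N + 1 →
      LinearIndependent K (fun i : T => φ (i : Fin s))) ∧
    (∀ i : Fin n, ∃ T : Finset (Fin s), T.card = N ∧ ∀ j ∈ T, φ j (p i).rep = 0) ∧
    (∀ T : Finset (Fin s), T.card = N → ∃ i : Fin n, ∀ j ∈ T, φ j (p i).rep = 0)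

/-- The Waldschmidt constant `γ(I) = lim_{m→∞} α(I^(m))/m = inf_{m≥1} α(I^(m))/m` of the
radical ideal `I = ⋂ᵢ I(pᵢ)` of a finite set of points. -/
def waldschmidt {K : Type*} [Field K] {N n : ℕ}
    (p : Fin n → ℙ K (Fin (N + 1) → K)) : ℝ :=
  ⨅ m : ℕ, (alphaDeg (⨅ i, (pointIdeal (p i)) ^ (m + 1)) : ℝ) / (m + 1)

/-- The linear form attached to a linear functional on `Kⁿ`. -/
def linForm {K : Type*} [Field K] {n : ℕ} (ψ : (Fin n → K) →ₗ[K] K) :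
    MvPolynomial (Fin n) K :=
  ∑ l, C (ψ (Pi.single l 1)) * X l

/-- Pullback of polynomial functions along a linear map. -/
def pullback {K : Type*} [Field K] {n k : ℕ} (A : (Fin k → K) →ₗ[K] (Fin n → K)) :
    MvPolynomial (Fin n) K →ₐ[K] MvPolynomial (Fin k) K :=
  aeval fun l => linForm (LinearMap.proj l ∘ₗ A)

/-- Generic expansion along the line spanned by `v`: `F(x) ↦ F(u • v + t • x)` as a polynomial
in `t` with coefficients in `K[x][u]`. A power `t ^ m` divides the result exactly when `F`
vanishes to order `m` along the line `K • v`. -/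
def lineExpansion {K : Type*} [Field K] {n : ℕ} (v : Fin n → K) :
    MvPolynomial (Fin n) K →ₐ[K] Polynomial (Polynomial (MvPolynomial (Fin n) K)) :=
  aeval fun l => Polynomial.C (Polynomial.X * Polynomial.C (C (v l))) +
    Polynomial.X * Polynomial.C (Polynomial.C (X l))

section LinearForms

variable {K : Type*} [Field K] {n k : ℕ}

lemma functional_apply_eq_sum (ψ : (Fin n → K) →ₗ[K] K) (v : Fin n → K) :
    ψ v = ∑ l, ψ (Pi.single l 1) * v l := by
  conv_lhs => rw [LinearMap.pi_apply_eq_sum_univ ψ v]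
  refine Finset.sum_congr rfl fun l _ => ?_
  rw [smul_eq_mul, mul_comm]
  congr 2
  ext j
  simp [Pi.single_apply, eq_comm]

lemma aeval_linForm {S : Type*} [CommSemiring S] [Algebra K S] (g : Fin n → S)
    (ψ : (Fin n → K) →ₗ[K] K) :
    aeval g (linForm ψ) = ∑ l, algebraMap K S (ψ (Pi.single l 1)) * g l := by
  simp [linForm]

lemma isHomogeneous_linForm (ψ : (Fin n → K) →ₗ[K] K) : (linForm ψ).IsHomogeneous 1 :=
  IsHomogeneous.sum _ _ _ fun _ _ => isHomogeneous_C_mul_X _ _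

lemma eval_linForm (ψ : (Fin n → K) →ₗ[K] K) (v : Fin n → K) :
    MvPolynomial.eval v (linForm ψ) = ψ v := by
  rw [functional_apply_eq_sum ψ v]
  simp [linForm]

lemma linForm_ne_zero {ψ : (Fin n → K) →ₗ[K] K} (hψ : ψ ≠ 0) : linForm ψ ≠ 0 := by
  intro h
  refine hψ (LinearMap.ext fun v => ?_)
  rw [← eval_linForm, h]
  simp

lemma linForm_proj (l : Fin n) : linForm (LinearMap.proj l : (Fin n → K) →ₗ[K] K) = X l := by
  simp [linForm, Pi.single_apply]

lemma linForm_add (ψ χ : (Fin n → K) →ₗ[K] K) :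
    linForm (ψ + χ) = linForm ψ + linForm χ := by
  simp [linForm, add_mul, Finset.sum_add_distrib]

lemma linForm_smul (c : K) (ψ : (Fin n → K) →ₗ[K] K) :
    linForm (c • ψ) = C c * linForm ψ := by
  simp [linForm, Finset.mul_sum, mul_assoc]

lemma linForm_zero : linForm (0 : (Fin n → K) →ₗ[K] K) = 0 := by
  simp [linForm]

lemma pullback_X (A : (Fin k → K) →ₗ[K] (Fin n → K)) (l : Fin n) :
    pullback A (X l) = linForm (LinearMap.proj l ∘ₗ A) := by
  simp [pullback]

lemma pullback_linForm (A : (Fin k → K) →ₗ[K] (Fin n → K)) (ψ : (Fin n → K) →ₗ[K] K) :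
    pullback A (linForm ψ) = linForm (ψ ∘ₗ A) := by
  rw [pullback, aeval_linForm]
  simp only [linForm, Finset.mul_sum, algebraMap_eq]
  rw [Finset.sum_comm]
  refine Finset.sum_congr rfl fun l _ => ?_
  simp only [LinearMap.comp_apply, LinearMap.proj_apply]
  rw [functional_apply_eq_sum ψ, map_sum, Finset.sum_mul]
  simp [mul_assoc]

lemma pullback_comp {j : ℕ} (A : (Fin k → K) →ₗ[K] (Fin n → K))
    (B : (Fin j → K) →ₗ[K] (Fin k → K)) :
    (pullback B).comp (pullback A) = pullback (A ∘ₗ B) := by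
  refine MvPolynomial.algHom_ext fun l => ?_
  rw [AlgHom.comp_apply, pullback_X, pullback_linForm, pullback_X, LinearMap.comp_assoc]

lemma totalDegree_pullback_le (A : (Fin k → K) →ₗ[K] (Fin n → K))
    (F : MvPolynomial (Fin n) K) : (pullback A F).totalDegree ≤ F.totalDegree := by
  conv_lhs => rw [← sum_homogeneousComponent F, map_sum]
  refine totalDegree_finsetSum_le fun i hi => ?_
  have h := (homogeneousComponent_isHomogeneous i F).aeval
    (fun l => linForm (LinearMap.proj l ∘ₗ A)) (n := 1) fun l => isHomogeneous_linForm _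
  have := h.totalDegree_le
  rw [pullback]
  simp only [Finset.mem_range] at hi
  omega

/-- A polynomial vanishing on the kernel of a nonzero functional is a multiple of its
linear form. -/
lemma linForm_dvd_iff {φ : (Fin n → K) →ₗ[K] K} (hφ : φ ≠ 0)
    (e : (Fin k → K) ≃ₗ[K] LinearMap.ker φ) (F : MvPolynomial (Fin n) K) :
    linForm φ ∣ F ↔ pullback ((LinearMap.ker φ).subtype ∘ₗ e.toLinearMap) F = 0 := by
  set B := (LinearMap.ker φ).subtype ∘ₗ e.toLinearMap with hB
  constructor
  · rintro ⟨G, rfl⟩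
    have : φ ∘ₗ B = 0 := LinearMap.ext fun x => (e x).2
    rw [map_mul, pullback_linForm, this, linForm_zero, zero_mul]
  intro h
  obtain ⟨u, hu⟩ : ∃ u, φ u = 1 := LinearMap.surjective hφ 1
  let P : (Fin n → K) →ₗ[K] LinearMap.ker φ :=
    (LinearMap.id - φ.smulRight u).codRestrict _ fun x => by simp [hu]
  let Q : (Fin n → K) →ₗ[K] (Fin n → K) := B ∘ₗ (e.symm.toLinearMap ∘ₗ P)
  have hQ : Q = LinearMap.id - φ.smulRight u := by
    refine LinearMap.ext fun x => ?_
    have hP : (P x : Fin n → K) = x - φ x • u := rfl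
    simp [Q, hB, hP]
  have hQF : pullback Q F = 0 := by
    rw [← pullback_comp, AlgHom.comp_apply, h, map_zero]
  rw [← Ideal.mem_span_singleton, ← Ideal.Quotient.eq_zero_iff_mem]
  have key : (Ideal.Quotient.mkₐ K (Ideal.span {linForm φ})).comp (pullback Q) =
      Ideal.Quotient.mkₐ K (Ideal.span {linForm φ}) := by
    refine MvPolynomial.algHom_ext fun l => ?_
    rw [AlgHom.comp_apply, pullback_X]
    have : LinearMap.proj l ∘ₗ Q = LinearMap.proj l + (-(u l)) • φ := by
      rw [hQ]
      ext x
      simp [sub_eq_add_neg, mul_comm]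
    rw [this, linForm_add, linForm_proj, linForm_smul, map_add, add_eq_left]
    exact Ideal.Quotient.eq_zero_iff_mem.2
      (Ideal.mul_mem_left _ _ (Ideal.mem_span_singleton_self _))
  have := DFunLike.congr_fun key F
  rw [AlgHom.comp_apply, hQF, map_zero] at this
  exact this.symm

lemma exists_equiv_ker {φ : (Fin (k + 1) → K) →ₗ[K] K} (hφ : φ ≠ 0) :
    Nonempty ((Fin k → K) ≃ₗ[K] LinearMap.ker φ) := by
  refine ⟨LinearEquiv.ofFinrankEq _ _ ?_⟩
  have := Module.Dual.finrank_ker_add_one_of_ne_zero (f := φ) hφ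
  simp at this ⊢
  omega

lemma prime_linForm {φ : (Fin (k + 1) → K) →ₗ[K] K} (hφ : φ ≠ 0) : Prime (linForm φ) := by
  obtain ⟨e⟩ := exists_equiv_ker hφ
  refine ⟨linForm_ne_zero hφ, fun h => ?_, fun a b h => ?_⟩
  · have := (linForm_dvd_iff hφ e 1).1 h.dvd
    simp at this
  · rw [linForm_dvd_iff hφ e] at h ⊢
    rw [linForm_dvd_iff hφ e, ← mul_eq_zero, ← map_mul]
    exact h

lemma totalDegree_linForm {φ : (Fin n → K) →ₗ[K] K} (hφ : φ ≠ 0) :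
    (linForm φ).totalDegree = 1 :=
  (isHomogeneous_linForm φ).totalDegree (linForm_ne_zero hφ)

lemma not_linForm_dvd_linForm {φ ψ : (Fin n → K) →ₗ[K] K} {v : Fin n → K}
    (hφ : φ v = 0) (hψ : ψ v ≠ 0) : ¬ linForm φ ∣ linForm ψ := by
  rintro ⟨G, hG⟩
  apply hψ
  rw [← eval_linForm, hG, map_mul, eval_linForm, hφ, zero_mul]

end LinearForms

section LineExpansion

variable {K : Type*} [Field K] {n k : ℕ}

lemma lineExpansion_linForm (v : Fin n → K) (ψ : (Fin n → K) →ₗ[K] K) :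
    lineExpansion v (linForm ψ) = Polynomial.C (Polynomial.X * Polynomial.C (C (ψ v))) +
      Polynomial.X * Polynomial.C (Polynomial.C (linForm ψ)) := by
  rw [lineExpansion, aeval_linForm, functional_apply_eq_sum ψ v, linForm]
  simp only [Polynomial.algebraMap_apply, algebraMap_eq]
  simp only [map_sum, Finset.mul_sum, ← Finset.sum_add_distrib]
  refine Finset.sum_congr rfl fun l _ => ?_
  simp only [Polynomial.C_mul, C_mul]
  ring

lemma lineExpansion_linForm_of_apply_eq_zero {v : Fin n → K} {ψ : (Fin n → K) →ₗ[K] K}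
    (h : ψ v = 0) :
    lineExpansion v (linForm ψ) = Polynomial.X * Polynomial.C (Polynomial.C (linForm ψ)) := by
  simp [lineExpansion_linForm, h]

lemma not_X_dvd_lineExpansion_linForm {v : Fin n → K} {ψ : (Fin n → K) →ₗ[K] K}
    (h : ψ v ≠ 0) : ¬ Polynomial.X ∣ lineExpansion v (linForm ψ) := by
  rw [Polynomial.X_dvd_iff, lineExpansion_linForm]
  simp [h]

/-- Vanishing to order `m` is inherited by restrictions to linear subspaces. -/
lemma X_pow_dvd_lineExpansion_pullback (A : (Fin k → K) →ₗ[K] (Fin n → K)) (w : Fin k → K)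
    {F : MvPolynomial (Fin n) K} {m : ℕ} (h : Polynomial.X ^ m ∣ lineExpansion (A w) F) :
    Polynomial.X ^ m ∣ lineExpansion w (pullback A F) := by
  let Φ := Polynomial.mapAlgHom (Polynomial.mapAlgHom (pullback A))
  have key : (lineExpansion w).comp (pullback A) = Φ.comp (lineExpansion (A w)) := by
    refine MvPolynomial.algHom_ext fun l => ?_
    rw [AlgHom.comp_apply, AlgHom.comp_apply, pullback_X, lineExpansion_linForm]
    simp [lineExpansion, Φ, pullback_X, algHom_C]
  have := map_dvd Φ h
  rw [map_pow] at this
  have hX : Φ Polynomial.X = Polynomial.X := by simp [Φ]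
  rw [hX] at this
  rwa [← AlgHom.comp_apply, key, AlgHom.comp_apply]

lemma eq_zero_of_X_dvd_lineExpansion {v : Fin 1 → K} (hv : v 0 ≠ 0)
    {F : MvPolynomial (Fin 1) K} (h : Polynomial.X ∣ lineExpansion v F) : F = 0 := by
  let g : Polynomial (Polynomial (MvPolynomial (Fin 1) K)) →ₐ[K] MvPolynomial (Fin 1) K :=
    ((Polynomial.aeval (C (v 0)⁻¹ * X 0 : MvPolynomial (Fin 1) K)).restrictScalars K).comp
      ((Polynomial.aeval (0 : Polynomial (MvPolynomial (Fin 1) K))).restrictScalars K)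
  have key : g.comp (lineExpansion v) = AlgHom.id K _ := by
    refine MvPolynomial.algHom_ext fun l => ?_
    obtain rfl : l = 0 := Subsingleton.elim _ _
    simp only [AlgHom.comp_apply, lineExpansion, aeval_X, g]
    simp [← mul_assoc, ← C_mul, mul_inv_cancel₀ hv, -map_inv₀]
  have hF : g (lineExpansion v F) = F := DFunLike.congr_fun key F
  obtain ⟨G, hG⟩ := h
  rw [← hF, hG, map_mul]
  simp [g]

lemma aeval_mul_of_isHomogeneous {S : Type*} [CommSemiring S] [Algebra K S] (u : S)
    (v : Fin n → K) {d : ℕ} {f : MvPolynomial (Fin n) K} (hf : f.IsHomogeneous d) :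
    aeval (fun l => u * algebraMap K S (v l)) f =
      u ^ d * algebraMap K S (MvPolynomial.eval v f) := by
  rw [aeval_def, eval₂_eq', MvPolynomial.eval_eq', map_sum, Finset.mul_sum]
  refine Finset.sum_congr rfl fun x hx => ?_
  have hd : ∑ i, x i = d := by
    rw [← Finsupp.degree_eq_sum]
    by_contra hne
    exact mem_support_iff.1 hx (hf.coeff_eq_zero hne)
  simp only [mul_pow, Finset.prod_mul_distrib, Finset.prod_pow_eq_pow_sum, hd, map_mul, map_prod,
    map_pow]
  ring

lemma pow_dvd_map_of_mem_span_pow {R S : Type*} [CommSemiring R] [CommSemiring S] (f : R →+* S)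
    {s : Set R} {x : S} (hs : ∀ a ∈ s, x ∣ f a) {m : ℕ} {a : R} (ha : a ∈ Ideal.span s ^ m) :
    x ^ m ∣ f a := by
  have hle : Ideal.span s ≤ (Ideal.span {x}).comap f := Ideal.span_le.2 fun a ha =>
    Ideal.mem_comap.2 (Ideal.mem_span_singleton.2 (hs a ha))
  have := Ideal.le_comap_pow f m (Ideal.pow_right_mono hle m ha)
  rwa [Ideal.span_singleton_pow, Ideal.mem_comap, Ideal.mem_span_singleton] at this

lemma X_dvd_lineExpansion_of_isHomogeneous {v : Fin n → K} {d : ℕ} {f : MvPolynomial (Fin n) K}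
    (hd : f.IsHomogeneous d) (hf : MvPolynomial.eval v f = 0) :
    Polynomial.X ∣ lineExpansion v f := by
  have key : ((Polynomial.aeval (0 : Polynomial (MvPolynomial (Fin n) K))).restrictScalars K).comp
      (lineExpansion v) =
      aeval fun l => Polynomial.X * algebraMap K (Polynomial (MvPolynomial (Fin n) K)) (v l) := by
    refine MvPolynomial.algHom_ext fun l => ?_
    simp [lineExpansion, Polynomial.algebraMap_apply]
  have h := DFunLike.congr_fun key f
  rw [aeval_mul_of_isHomogeneous _ _ hd, hf, map_zero, mul_zero, AlgHom.comp_apply] at h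
  rw [Polynomial.X_dvd_iff, Polynomial.coeff_zero_eq_aeval_zero]
  exact h

lemma X_pow_dvd_lineExpansion_of_mem {N m : ℕ} {q : ℙ K (Fin (N + 1) → K)}
    {F : MvPolynomial (Fin (N + 1)) K} (h : F ∈ pointIdeal q ^ m) :
    Polynomial.X ^ m ∣ lineExpansion q.rep F := by
  refine pow_dvd_map_of_mem_span_pow
    (S := Polynomial (Polynomial (MvPolynomial (Fin (N + 1)) K)))
    (lineExpansion q.rep).toRingHom ?_ h
  rintro f ⟨⟨d, hd⟩, hf⟩
  exact X_dvd_lineExpansion_of_isHomogeneous hd hf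

end LineExpansion

section StarConfiguration

variable {K : Type*} [Field K] {ι : Type*} [DecidableEq ι] {k : ℕ}

lemma exists_card_eq_and_mem_and_notMem {S : Finset ι} {i j : ι} (hi : i ∈ S) (hij : j ≠ i)
    (hk : k + 1 < S.card) : ∃ T ⊆ S, T.card = k + 1 ∧ i ∈ T ∧ j ∉ T := by
  have h1 : {i} ⊆ S.erase j := by simpa [hij.symm] using hi
  have h2 : k + 1 ≤ (S.erase j).card := by
    have := Finset.pred_card_le_card_erase (s := S) (a := j)
    omega
  obtain ⟨T, hT1, hT2, hT3⟩ :=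
    Finset.exists_subsuperset_card_eq h1 (n := k + 1) (by simp) h2
  exact ⟨T, hT2.trans (Finset.erase_subset _ _), hT3, hT1 (Finset.mem_singleton_self i),
    fun h => (Finset.mem_erase.1 (hT2 h)).1 rfl⟩

/-- Dividing by the product of the hyperplanes lowers the order of vanishing at `v`
by the number of hyperplanes through `v`. -/
lemma X_pow_dvd_lineExpansion_of_prod_mul {n : ℕ} {S T : Finset ι} (hTS : T ⊆ S)
    {φ : ι → (Fin n → K) →ₗ[K] K} {v : Fin n → K} (hφ : ∀ j ∈ S, φ j ≠ 0)
    (hv : ∀ j ∈ S, φ j v = 0 ↔ j ∈ T) {G : MvPolynomial (Fin n) K} {m : ℕ}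
    (h : Polynomial.X ^ (T.card + m) ∣ lineExpansion v ((∏ j ∈ S, linForm (φ j)) * G)) :
    Polynomial.X ^ m ∣ lineExpansion v G := by
  set W := (∏ j ∈ S \ T, lineExpansion v (linForm (φ j))) *
    ∏ j ∈ T, Polynomial.C (Polynomial.C (linForm (φ j))) with hW
  have hfac : lineExpansion v ((∏ j ∈ S, linForm (φ j)) * G) =
      Polynomial.X ^ T.card * (W * lineExpansion v G) := by
    rw [map_mul, map_prod, ← Finset.prod_sdiff hTS,
      Finset.prod_congr rfl fun j hj =>
        lineExpansion_linForm_of_apply_eq_zero ((hv j (hTS hj)).2 hj),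
      Finset.prod_mul_distrib, Finset.prod_const, hW]
    ring
  have hWX : ¬ Polynomial.X ∣ W := by
    rw [hW, Polynomial.prime_X.dvd_mul, Polynomial.prime_X.dvd_finsetProd_iff,
      Polynomial.prime_X.dvd_finsetProd_iff]
    rintro (⟨j, hj, h⟩ | ⟨j, hj, h⟩)
    · rw [Finset.mem_sdiff] at hj
      exact not_X_dvd_lineExpansion_linForm (fun h0 => hj.2 ((hv j hj.1).1 h0)) h
    · rw [Polynomial.X_dvd_iff, Polynomial.coeff_C_zero, Polynomial.C_eq_zero] at h
      exact linForm_ne_zero (hφ j (hTS hj)) h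
  rw [hfac, pow_add, mul_dvd_mul_iff_left (pow_ne_zero _ Polynomial.X_ne_zero)] at h
  exact Polynomial.prime_X.pow_dvd_of_dvd_mul_left m hWX h

/-- A nonzero polynomial vanishing to order `m` at all points of a star configuration on
`#S > k` hyperplanes of `ℙᵏ` has degree at least `m + ⌈m / k⌉ (#S - k)`. -/
theorem le_totalDegree_of_star : ∀ (k : ℕ) (S : Finset ι) (φ : ι → (Fin (k + 1) → K) →ₗ[K] K)
    (v : Finset ι → Fin (k + 1) → K), k < S.card →
    (∀ T ⊆ S, T.card = k → ∀ j ∈ S, φ j (v T) = 0 ↔ j ∈ T) →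
    ∀ (m q : ℕ) (F : MvPolynomial (Fin (k + 1)) K), F ≠ 0 →
    (∀ T ⊆ S, T.card = k → Polynomial.X ^ m ∣ lineExpansion (v T) F) → q * k < m →
    m + (q + 1) * (S.card - k) ≤ F.totalDegree := by
  intro k
  induction k with
  | zero =>
    intro S φ v hS hv m q F hF hdvd hq
    obtain ⟨j, hj⟩ := Finset.card_pos.1 hS
    have hj0 : φ j (v ∅) ≠ 0 := by simp [hv ∅ (Finset.empty_subset _) rfl j hj]
    have hv0 : v ∅ 0 ≠ 0 := by
      intro h
      apply hj0
      rw [show v ∅ = 0 from funext fun l => by rw [show l = 0 from Fin.ext (by omega), h]; rfl, map_zero]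
    exact absurd (eq_zero_of_X_dvd_lineExpansion hv0
      ((dvd_pow_self _ (by omega)).trans (hdvd ∅ (Finset.empty_subset _) rfl))) hF
  | succ k ih =>
    intro S φ v hS hv m
    have hφ : ∀ j ∈ S, φ j ≠ 0 := by
      intro j hj h
      obtain ⟨i, hi, hij⟩ := Finset.exists_mem_ne (s := S) (by omega) j
      obtain ⟨T, hT, hTc, -, hjT⟩ := exists_card_eq_and_mem_and_notMem hi hij.symm hS
      exact hjT ((hv T hT hTc j hj).1 (by simp [h]))
    induction m using Nat.strong_induction_on with
    | _ m ihm =>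
    intro q F hF hdvd hq
    by_cases hall : ∀ i ∈ S, linForm (φ i) ∣ F
    · have hrel : (S : Set ι).Pairwise (Function.onFun IsRelPrime fun i => linForm (φ i)) := by
        intro i hi j hj hij
        obtain ⟨T, hT, hTc, hiT, hjT⟩ := exists_card_eq_and_mem_and_notMem hi hij.symm hS
        exact (prime_linForm (hφ i hi)).irreducible.isRelPrime_iff_not_dvd.2
          (not_linForm_dvd_linForm ((hv T hT hTc i hi).2 hiT)
            fun h => hjT ((hv T hT hTc j hj).1 h))
      obtain ⟨G, rfl⟩ := Finset.prod_dvd_of_isRelPrime hrel hall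
      have hG : G ≠ 0 := right_ne_zero_of_mul hF
      have hdeg : ((∏ j ∈ S, linForm (φ j)) * G).totalDegree = S.card + G.totalDegree := by
        have hP := IsHomogeneous.prod S (fun j => linForm (φ j)) (fun _ => 1)
          fun j _ => isHomogeneous_linForm (φ j)
        rw [totalDegree_mul_of_isDomain (left_ne_zero_of_mul hF) hG,
          hP.totalDegree (left_ne_zero_of_mul hF)]
        simp
      rw [hdeg]
      obtain hm | hm := le_or_gt m (k + 1)
      · obtain rfl : q = 0 := by
          by_contra h
          have := Nat.le_mul_of_pos_left (k + 1) (Nat.pos_of_ne_zero h)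
          omega
        omega
      · have hG' : ∀ T ⊆ S, T.card = k + 1 →
            Polynomial.X ^ (m - (k + 1)) ∣ lineExpansion (v T) G := by
          intro T hT hTc
          refine X_pow_dvd_lineExpansion_of_prod_mul hT hφ (hv T hT hTc) ?_
          rw [hTc, Nat.add_sub_cancel' hm.le]
          exact hdvd T hT hTc
        cases q with
        | zero =>
          have := ihm (m - (k + 1)) (by omega) 0 G hG hG' (by omega)
          omega
        | succ q =>
          rw [add_one_mul] at hq
          have := ihm (m - (k + 1)) (by omega) q G hG hG' (by omega)
          rw [add_one_mul (q + 1)]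
          omega
    · push Not at hall
      obtain ⟨i, hi, hdiv⟩ := hall
      obtain ⟨e⟩ := exists_equiv_ker (hφ i hi)
      set B := (LinearMap.ker (φ i)).subtype ∘ₗ e.toLinearMap with hB
      have hBF : pullback B F ≠ 0 := fun h => hdiv ((linForm_dvd_iff (hφ i hi) e F).2 h)
      have hcard : (S.erase i).card = S.card - 1 := Finset.card_erase_of_mem hi
      have hins : ∀ T ⊆ S.erase i, T.card = k → insert i T ⊆ S ∧ (insert i T).card = k + 1 := by
        intro T hT hTc
        refine ⟨Finset.insert_subset hi (hT.trans (Finset.erase_subset _ _)), ?_⟩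
        rw [Finset.card_insert_of_notMem fun h => (Finset.mem_erase.1 (hT h)).1 rfl, hTc]
      have hsurj : ∀ T, ∃ w, T ⊆ S.erase i → T.card = k → B w = v (insert i T) := by
        intro T
        by_cases h : T ⊆ S.erase i ∧ T.card = k
        · obtain ⟨h1, h2⟩ := hins T h.1 h.2
          refine ⟨e.symm ⟨v (insert i T),
            (hv _ h1 h2 i hi).2 (Finset.mem_insert_self _ _)⟩, fun _ _ => ?_⟩
          simp [hB]
        · exact ⟨0, fun h1 h2 => absurd ⟨h1, h2⟩ h⟩
      choose w hw using hsurj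
      have := ih (S.erase i) (fun j => φ j ∘ₗ B) w (by omega) ?_ m q (pullback B F) hBF ?_
        (lt_of_le_of_lt (Nat.mul_le_mul_left q k.le_succ) hq)
      · rw [hcard, Nat.sub_sub, add_comm 1 k] at this
        exact this.trans (totalDegree_pullback_le B F)
      · intro T hT hTc j hj
        obtain ⟨h1, h2⟩ := hins T hT hTc
        rw [Finset.mem_erase] at hj
        rw [LinearMap.comp_apply, hw T hT hTc, hv _ h1 h2 j hj.2]
        simp [hj.1]
      · intro T hT hTc
        obtain ⟨h1, h2⟩ := hins T hT hTc
        refine X_pow_dvd_lineExpansion_pullback B (w T) ?_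
        rw [hw T hT hTc]
        exact hdvd _ h1 h2

end StarConfiguration

section Alpha

lemma alphaDeg_le {σ K : Type*} [CommSemiring K] {J : Ideal (MvPolynomial σ K)} {d : ℕ}
    {f : MvPolynomial σ K} (hf : f ∈ J) (h0 : f ≠ 0) (hd : f.IsHomogeneous d) :
    alphaDeg J ≤ d :=
  Nat.sInf_le ⟨f, hf, h0, hd⟩

variable {K : Type*} [Field K] {N n : ℕ}

lemma pointIdeal_le_idealOfVars (q : ℙ K (Fin (N + 1) → K)) :
    pointIdeal q ≤ idealOfVars (Fin (N + 1)) K := by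
  refine Ideal.span_le.2 ?_
  rintro f ⟨⟨d, hd⟩, hf⟩
  rw [SetLike.mem_coe, ← pow_one (idealOfVars _ _), mem_pow_idealOfVars_iff']
  intro x hx
  obtain rfl : x = 0 := (Finsupp.degree_eq_zero_iff x).1 (by omega)
  by_contra hne
  have hd0 : d = 0 := by
    by_contra h
    exact hne (hd.coeff_eq_zero (by simpa using Ne.symm h))
  subst hd0
  rw [← totalDegree_zero_iff_isHomogeneous, totalDegree_eq_zero_iff_eq_C] at hd
  rw [hd, eval_C] at hf
  exact hne hf

lemma le_degree_of_mem_pointIdeal_pow {q : ℙ K (Fin (N + 1) → K)} {m : ℕ}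
    {F : MvPolynomial (Fin (N + 1)) K} (hF : F ≠ 0) (h : F ∈ pointIdeal q ^ m) :
    m ≤ F.totalDegree := by
  obtain ⟨x, hx⟩ := support_nonempty.2 hF
  exact ((mem_pow_idealOfVars_iff m F).1
    (Ideal.pow_right_mono (pointIdeal_le_idealOfVars q) m h) x hx).trans (le_totalDegree hx)

lemma linForm_mem_pointIdeal {q : ℙ K (Fin (N + 1) → K)} {φ : (Fin (N + 1) → K) →ₗ[K] K}
    (h : φ q.rep = 0) : linForm φ ∈ pointIdeal q :=
  Ideal.subset_span ⟨⟨1, isHomogeneous_linForm φ⟩, by rw [eval_linForm, h]⟩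

lemma exists_linForm_mem_pointIdeal (hN : 0 < N) (q : ℙ K (Fin (N + 1) → K)) :
    ∃ φ : (Fin (N + 1) → K) →ₗ[K] K, φ ≠ 0 ∧ linForm φ ∈ pointIdeal q := by
  have hlt : K ∙ q.rep < ⊤ := by
    refine Submodule.lt_top_of_finrank_lt_finrank ((finrank_span_le_card _).trans_lt ?_)
    simpa using hN
  obtain ⟨φ, hφ, hle⟩ := Submodule.exists_le_ker_of_lt_top _ hlt
  exact ⟨φ, hφ, linForm_mem_pointIdeal (hle (Submodule.mem_span_singleton_self _))⟩

lemma exists_form_mem_iInf_pow (hN : 0 < N) (p : Fin n → ℙ K (Fin (N + 1) → K)) (m : ℕ) :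
    ∃ d, ∃ f ∈ ⨅ i, pointIdeal (p i) ^ m, f ≠ 0 ∧ f.IsHomogeneous d := by
  choose φ hφ hmem using fun i => exists_linForm_mem_pointIdeal hN (p i)
  refine ⟨_, ∏ i, linForm (φ i) ^ m, ?_, ?_, IsHomogeneous.prod _ _ _ fun i _ =>
    (isHomogeneous_linForm (φ i)).pow m⟩
  · refine Ideal.mem_iInf.2 fun i => ?_
    exact Ideal.mem_of_dvd _ (Finset.dvd_prod_of_mem _ (Finset.mem_univ i))
      (Ideal.pow_mem_pow (hmem i) m)
  · exact Finset.prod_ne_zero_iff.2 fun i _ => pow_ne_zero _ (linForm_ne_zero (hφ i))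

lemma le_alphaDeg_iInf_pow (hN : 0 < N) (p : Fin n → ℙ K (Fin (N + 1) → K)) {m b : ℕ}
    (h : ∀ F ∈ ⨅ i, pointIdeal (p i) ^ m, F ≠ 0 → b ≤ F.totalDegree) :
    b ≤ alphaDeg (⨅ i, pointIdeal (p i) ^ m) := by
  obtain ⟨f, hf, h0, hd⟩ := Nat.sInf_mem (exists_form_mem_iInf_pow hN p m)
  exact (h f hf h0).trans hd.totalDegree_le

lemma le_alphaDeg_iInf_pow_self (hN : 0 < N) (hn : 0 < n) (p : Fin n → ℙ K (Fin (N + 1) → K))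
    (m : ℕ) : m ≤ alphaDeg (⨅ i, pointIdeal (p i) ^ m) :=
  le_alphaDeg_iInf_pow hN p fun _ hF h0 =>
    le_degree_of_mem_pointIdeal_pow h0 (Ideal.mem_iInf.1 hF ⟨0, hn⟩)

lemma pointIdeal_eq_bot (q : ℙ K (Fin (0 + 1) → K)) : pointIdeal q = ⊥ := by
  rw [eq_bot_iff]
  intro F hF
  refine eq_zero_of_X_dvd_lineExpansion (v := q.rep) (fun h => q.rep_nonzero ?_) ?_
  · exact funext fun l => by rw [show l = 0 from Fin.ext (by omega), h]; rfl
  · have := X_pow_dvd_lineExpansion_of_mem (m := 1) (by rwa [pow_one])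
    rwa [pow_one] at this

lemma alphaDeg_bot {σ K : Type*} [CommSemiring K] :
    alphaDeg (⊥ : Ideal (MvPolynomial σ K)) = 0 := by
  have : {d : ℕ | ∃ f ∈ (⊥ : Ideal (MvPolynomial σ K)), f ≠ 0 ∧ f.IsHomogeneous d} = ∅ :=
    Set.eq_empty_of_forall_notMem fun _ ⟨_, hf, h0, _⟩ => h0 hf
  rw [alphaDeg, this, Nat.sInf_empty]

lemma waldschmidt_mul_le (p : Fin n → ℙ K (Fin (N + 1) → K)) (m : ℕ) :
    waldschmidt p * (m + 1) ≤ alphaDeg (⨅ i, pointIdeal (p i) ^ (m + 1)) := by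
  rw [← le_div_iff₀ (by positivity)]
  exact ciInf_le ⟨0, by rintro _ ⟨m, rfl⟩; positivity⟩ m

/-- Linear functionals in general position: any `N + 1` of them have no common zero. -/
lemma eq_zero_of_linearIndependent {ι : Type*} {φ : ι → (Fin (N + 1) → K) →ₗ[K] K}
    {T : Finset ι} (hli : LinearIndependent K fun i : T => φ i) (hT : T.card = N + 1)
    {v : Fin (N + 1) → K} (hv : ∀ j ∈ T, φ j v = 0) : v = 0 := by
  have hspan : Submodule.span K (Set.range fun i : T => φ i) = ⊤ :=
    hli.span_eq_top_of_card_eq_finrank' (by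
      rw [Fintype.card_coe, hT, show Module.finrank K ((Fin (N + 1) → K) →ₗ[K] K) =
        Module.finrank K (Module.Dual K (Fin (N + 1) → K)) from rfl, Subspace.dual_finrank_eq]
      simp)
  have hle : Submodule.span K (Set.range fun i : T => φ i) ≤
      LinearMap.ker (Module.Dual.eval K (Fin (N + 1) → K) v) := by
    refine Submodule.span_le.2 ?_
    rintro _ ⟨j, rfl⟩
    exact hv j j.2
  rw [hspan, top_le_iff] at hle
  refine (Module.forall_dual_apply_eq_zero_iff K v).1 fun ψ => ?_
  have : ψ ∈ LinearMap.ker (Module.Dual.eval K (Fin (N + 1) → K) v) := hle ▸ Submodule.mem_top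
  exact this

lemma IsStarConfiguration.alphaDeg_le {s : ℕ} {p : Fin n → ℙ K (Fin (N + 1) → K)}
    (h : IsStarConfiguration s p) (hN : 0 < N) :
    alphaDeg (⨅ i, pointIdeal (p i)) ≤ s - N + 1 := by
  obtain ⟨hs, -, -, φ, hli, hp, -⟩ := h
  have hφ : ∀ j, φ j ≠ 0 := fun j => (hli {j} (by simp)).ne_zero ⟨j, by simp⟩
  obtain ⟨U, -, hU⟩ := Finset.exists_subset_card_eq
    (s := (Finset.univ : Finset (Fin s))) (n := s - N + 1) (by simp; omega)
  have hd := IsHomogeneous.prod U (fun j => linForm (φ j)) (fun _ => 1)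
    fun j _ => isHomogeneous_linForm (φ j)
  rw [Finset.sum_const, hU, smul_eq_mul, mul_one] at hd
  refine _root_.alphaDeg_le (Ideal.mem_iInf.2 fun i => ?_)
    (Finset.prod_ne_zero_iff.2 fun j _ => linForm_ne_zero (hφ j)) hd
  obtain ⟨T, hT, hTp⟩ := hp i
  obtain ⟨j, hj⟩ : (U ∩ T).Nonempty := by
    rw [← Finset.card_pos]
    have h1 := Finset.card_union_add_card_inter U T
    have h2 := Finset.card_le_univ (U ∪ T)
    rw [Fintype.card_fin] at h2
    omega
  rw [Finset.mem_inter] at hj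
  exact Ideal.mem_of_dvd _ (Finset.dvd_prod_of_mem _ hj.1)
    (linForm_mem_pointIdeal (hTp j hj.2))

lemma IsStarConfiguration.le_alphaDeg {s : ℕ} {p : Fin n → ℙ K (Fin (N + 1) → K)}
    (h : IsStarConfiguration s p) (hN : 0 < N) (hs : N < s) {m q : ℕ} (hq : q * N < m) :
    m + (q + 1) * (s - N) ≤ alphaDeg (⨅ i, pointIdeal (p i) ^ m) := by
  obtain ⟨-, -, -, φ, hli, -, hT⟩ := h
  refine le_alphaDeg_iInf_pow hN p fun F hF h0 => ?_
  have hex : ∀ T : Finset (Fin s), ∃ i, T.card = N → ∀ j ∈ T, φ j (p i).rep = 0 := by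
    intro T
    by_cases hc : T.card = N
    · obtain ⟨i, hi⟩ := hT T hc
      exact ⟨i, fun _ => hi⟩
    · obtain ⟨U, -, hU⟩ := Finset.exists_subset_card_eq
        (s := (Finset.univ : Finset (Fin s))) (n := N) (by simp; omega)
      exact ⟨(hT U hU).choose, fun h => absurd h hc⟩
  choose i hi using hex
  have := le_totalDegree_of_star N Finset.univ φ (fun T => (p (i T)).rep) (by simpa using hs)
    ?_ m q F h0 (fun T _ _ => X_pow_dvd_lineExpansion_of_mem (Ideal.mem_iInf.1 hF _)) hq
  · simpa using this
  · refine fun T _ hc j _ => ⟨fun hj => ?_, hi T hc j⟩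
    by_contra hjT
    have hc' : (insert j T).card = N + 1 := by rw [Finset.card_insert_of_notMem hjT, hc]
    refine (p (i T)).rep_nonzero (eq_zero_of_linearIndependent (hli _ hc'.le) hc' fun l hl => ?_)
    obtain rfl | hl := Finset.mem_insert.1 hl
    · exact hj
    · exact hi T hc l hl

end Alpha

/-- for the radical ideal `I` of a finite set of distinct points of `ℙ^N`,
if `α(I) = 1`, or the points form a star configuration, or `γ(I) > (α(I)+N-1)/N`, then
`α(I^(Nr-N+1)) ≥ r·α(I) + (r-1)(N-1)` for all sufficiently large `r`. -/
theorem stmt19 {K : Type*} [Field K] {N n : ℕ} (hn : 0 < n)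
    (p : Fin n → ℙ K (Fin (N + 1) → K)) (hinj : Function.Injective p)
    (hcase : alphaDeg (⨅ i, pointIdeal (p i)) = 1 ∨
      (∃ s : ℕ, IsStarConfiguration s p) ∨
      waldschmidt p > ((alphaDeg (⨅ i, pointIdeal (p i)) : ℝ) + N - 1) / N) :
    ∃ r₀ : ℕ, ∀ r : ℕ, r₀ ≤ r →
      r * alphaDeg (⨅ i, pointIdeal (p i)) + (r - 1) * (N - 1) ≤
        alphaDeg (⨅ i, (pointIdeal (p i)) ^ (N * r - N + 1)) := by
  obtain rfl | hN := Nat.eq_zero_or_pos N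
  · refine ⟨0, fun r _ => ?_⟩
    have : Nonempty (Fin n) := ⟨⟨0, hn⟩⟩
    simp [pointIdeal_eq_bot, alphaDeg_bot]
  have hlinear : alphaDeg (⨅ i, pointIdeal (p i)) ≤ 1 → ∃ r₀ : ℕ, ∀ r : ℕ, r₀ ≤ r →
      r * alphaDeg (⨅ i, pointIdeal (p i)) + (r - 1) * (N - 1) ≤
        alphaDeg (⨅ i, (pointIdeal (p i)) ^ (N * r - N + 1)) := by
    refine fun hα => ⟨1, fun r hr => le_trans ?_ (le_alphaDeg_iInf_pow_self hN hn p _)⟩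
    obtain ⟨r, rfl⟩ := Nat.exists_eq_add_of_le' hr
    obtain ⟨M, rfl⟩ := Nat.exists_eq_add_of_le' hN
    have := Nat.mul_le_mul_left (r + 1) hα
    have h : (M + 1) * (r + 1) - (M + 1) = (M + 1) * r := by rw [mul_add_one]; omega
    rw [h]
    simp only [Nat.add_sub_cancel]
    nlinarith
  rcases hcase with hα | ⟨s, hstar⟩ | hγ
  · exact hlinear hα.le
  · have hα := hstar.alphaDeg_le hN
    obtain rfl | hs := hstar.1.eq_or_lt
    · exact hlinear (by simpa using hα)
    refine ⟨1, fun r hr => ?_⟩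
    obtain ⟨r, rfl⟩ := Nat.exists_eq_add_of_le' hr
    have h : N * (r + 1) - N = r * N := by rw [mul_add_one, mul_comm]; omega
    have hb := hstar.le_alphaDeg hN hs (m := N * (r + 1) - N + 1) (q := r) (by omega)
    refine le_trans ?_ hb
    obtain ⟨M, rfl⟩ := Nat.exists_eq_add_of_le' hN
    have := Nat.mul_le_mul_left (r + 1) hα
    rw [h]
    simp only [Nat.add_sub_cancel]
    nlinarith
  · set α := alphaDeg (⨅ i, pointIdeal (p i)) with hα
    set c : ℝ := ((α : ℝ) + N - 1) / N with hc
    have hN' : (0 : ℝ) < N := by exact_mod_cast hN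
    have hN1 : (1 : ℝ) ≤ N := by exact_mod_cast hN
    have hcN : c * N = α + N - 1 := by rw [hc]; field_simp
    have hε : 0 < waldschmidt p - c := sub_pos.2 hγ
    obtain ⟨r₁, hr₁⟩ := exists_nat_ge (α / (waldschmidt p - c))
    refine ⟨r₁ + 1, fun r hr => ?_⟩
    obtain ⟨r, rfl⟩ := Nat.exists_eq_add_of_le' (show 1 ≤ r by omega)
    have h : N * (r + 1) - N = N * r := by rw [mul_add_one]; omega
    rw [h]
    have hb := waldschmidt_mul_le p (N * r)
    have hr' : α ≤ r * (waldschmidt p - c) := by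
      rw [div_le_iff₀ hε] at hr₁
      refine hr₁.trans (mul_le_mul_of_nonneg_right ?_ hε.le)
      exact_mod_cast (by omega : r₁ ≤ r)
    have hc0 : 0 ≤ c := div_nonneg (by linarith [(Nat.cast_nonneg α : (0 : ℝ) ≤ α)]) hN'.le
    have key : ((r : ℝ) + 1) * α + r * (N - 1) ≤ waldschmidt p * ((N * r : ℕ) + 1) := by
      have h1 : (r : ℝ) * (waldschmidt p - c) ≤ N * (r * (waldschmidt p - c)) :=
        le_mul_of_one_le_left (by positivity) hN1
      push_cast
      calc ((r : ℝ) + 1) * α + r * (N - 1) = α + c * N * r := by rw [hcN]; ring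
        _ ≤ N * (r * (waldschmidt p - c)) + c * N * r + waldschmidt p := by linarith
        _ = waldschmidt p * (N * r + 1) := by ring
    have := key.trans hb
    rw [Nat.add_sub_cancel]
    obtain ⟨M, rfl⟩ := Nat.exists_eq_add_of_le' hN
    rw [Nat.add_sub_cancel]
    push_cast at this
    rw [add_sub_cancel_right] at this
    exact_mod_cast this

end
end
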